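/- arXiv:2310.18730 — 4 statements merged into one kernel-verified Lean document; each statement's English description precedes it below -/
import Mathlib

section
/- Let A ∈ DM_loc(Ω), λ : Ω → [0,1] Borel, and u ∈ BV^{A,λ}(Ω) with supp(u) compactly contained in Ω. Then ∫_Ω u^λ d(div A) = -∫_Ω d(A, Du)_λ. -/
open MeasureTheory Filter Topology Metric Set ENNReal NNReal

noncomputable section

abbrev RN (N : ℕ) := EuclideanSpace ℝ (Fin N)

/-- A real Radon measure on `Ω`, locally finite on `Ω`, given by its Jordan decomposition. -/
structure LocM (N : ℕ) (Ω : Set (RN N)) where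
  pos : Measure (RN N)
  neg : Measure (RN N)
  singular : pos ⟂ₘ neg
  posNull : pos Ωᶜ = 0
  negNull : neg Ωᶜ = 0
  posLoc : ∀ x ∈ Ω, ∃ s ∈ 𝓝 x, pos s < ⊤
  negLoc : ∀ x ∈ Ω, ∃ s ∈ 𝓝 x, neg s < ⊤

namespace LocM

variable {N : ℕ} {Ω : Set (RN N)}

/-- Integral of a real function against a (signed) local measure. -/
def intg (μ : LocM N Ω) (f : RN N → ℝ) : ℝ :=
  ∫ x, f x ∂μ.pos - ∫ x, f x ∂μ.neg

/-- Total variation measure. -/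
def var (μ : LocM N Ω) : Measure (RN N) := μ.pos + μ.neg

/-- Signed value of a set. -/
def rval (μ : LocM N Ω) (s : Set (RN N)) : ℝ := (μ.pos s).toReal - (μ.neg s).toReal

end LocM

/-- A finite real Radon measure on `Ω`. -/
structure FM (N : ℕ) (Ω : Set (RN N)) where
  pos : Measure (RN N)
  neg : Measure (RN N)
  posFin : IsFiniteMeasure pos
  negFin : IsFiniteMeasure neg
  singular : pos ⟂ₘ neg
  posNull : pos Ωᶜ = 0
  negNull : neg Ωᶜ = 0

namespace FM

variable {N : ℕ} {Ω : Set (RN N)}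

def intg (μ : FM N Ω) (f : RN N → ℝ) : ℝ :=
  ∫ x, f x ∂μ.pos - ∫ x, f x ∂μ.neg

def var (μ : FM N Ω) : Measure (RN N) := μ.pos + μ.neg

def rval (μ : FM N Ω) (s : Set (RN N)) : ℝ := (μ.pos s).toReal - (μ.neg s).toReal

/-- Total variation of `Ω` (the total mass). -/
def tv (μ : FM N Ω) : ℝ := (μ.pos Set.univ).toReal + (μ.neg Set.univ).toReal

end FM

/-- Smooth compactly supported test functions in `Ω`. -/
def IsTest {N : ℕ} (Ω : Set (RN N)) (φ : RN N → ℝ) : Prop :=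
  ContDiff ℝ (⊤ : ℕ∞) φ ∧ HasCompactSupport φ ∧ tsupport φ ⊆ Ω

/-- C¹ compactly supported test functions in `Ω`. -/
def IsTest1 {N : ℕ} (Ω : Set (RN N)) (φ : RN N → ℝ) : Prop :=
  ContDiff ℝ 1 φ ∧ HasCompactSupport φ ∧ tsupport φ ⊆ Ω

/-- `i`-th partial derivative. -/
def gradComp {N : ℕ} (φ : RN N → ℝ) (i : Fin N) (x : RN N) : ℝ :=
  fderiv ℝ φ x (EuclideanSpace.single i 1)

/-- The total variation measure `|A|` (up to equivalence) of a vector measure `A`. -/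
def varSum {N : ℕ} {Ω : Set (RN N)} (A : Fin N → LocM N Ω) : Measure (RN N) :=
  ∑ i, (A i).var

def varSumF {N : ℕ} {Ω : Set (RN N)} (A : Fin N → FM N Ω) : Measure (RN N) :=
  ∑ i, (A i).var

/-- `σ` is the distributional divergence of the vector measure `A` on `Ω`. -/
def IsDivergence {N : ℕ} (Ω : Set (RN N)) (A : Fin N → LocM N Ω) (σ : LocM N Ω) : Prop :=
  ∀ φ : RN N → ℝ, IsTest Ω φ →
    σ.intg φ = - ∑ i, (A i).intg (gradComp φ i)

def IsDivergenceF {N : ℕ} (Ω : Set (RN N)) (A : Fin N → FM N Ω) (σ : FM N Ω) : Prop :=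
  ∀ φ : RN N → ℝ, IsTest Ω φ →
    σ.intg φ = - ∑ i, (A i).intg (gradComp φ i)

/-- The Lebesgue density of `E` at `x` exists and equals `d`. -/
def hasDensity {N : ℕ} (E : Set (RN N)) (x : RN N) (d : ℝ) : Prop :=
  Tendsto (fun r : ℝ => (volume (E ∩ ball x r)).toReal / (volume (ball x r)).toReal)
    (𝓝[>] 0) (𝓝 d)

/-- Points of density 1: `E¹`. -/
def densOne {N : ℕ} (E : Set (RN N)) : Set (RN N) := {x | hasDensity E x 1}

/-- Measure-theoretic boundary `∂*E`. -/
def essBdry {N : ℕ} (E : Set (RN N)) : Set (RN N) :=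
  {x | ¬ hasDensity E x 0 ∧ ¬ hasDensity E x 1}

/-- The boundary `∂⁻E`. -/
def minusBdry {N : ℕ} (E : Set (RN N)) : Set (RN N) :=
  {x | ∀ r : ℝ, 0 < r → 0 < volume (E ∩ ball x r) ∧ volume (E ∩ ball x r) < volume (ball x r)}

/-- Approximate liminf `u⁻`. -/
def aliminf {N : ℕ} (u : RN N → ℝ) (x : RN N) : EReal :=
  sSup {t : EReal | hasDensity {y | ((u y : EReal)) < t} x 0}

/-- Approximate limsup `u⁺`. -/
def alimsup {N : ℕ} (u : RN N → ℝ) (x : RN N) : EReal :=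
  sInf {t : EReal | hasDensity {y | t < ((u y : EReal))} x 0}

/-- The `λ`-representative `u^λ = (1-λ)u⁻ + λu⁺`, with the convention
`u^λ = (2λ-1)·(+∞)` (and `0·∞ = 0`) on `Z_u = {u⁺ = +∞, u⁻ = -∞}`. -/
def lrep {N : ℕ} (u lam : RN N → ℝ) (x : RN N) : EReal :=
  if alimsup u x = ⊤ ∧ aliminf u x = ⊥ then ((2 * lam x - 1 : ℝ) : EReal) * (⊤ : EReal)
  else ((1 - lam x : ℝ) : EReal) * aliminf u x + ((lam x : ℝ) : EReal) * alimsup u x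

/-- `lam` is a Borel function with values in `[0,1]`. -/
def IsLam {N : ℕ} (lam : RN N → ℝ) : Prop :=
  Measurable lam ∧ ∀ x, lam x ∈ Icc (0:ℝ) 1

/-- An extended-real valued function belongs to `L¹(μ)`. -/
def Fin1 {N : ℕ} (f : RN N → EReal) (μ : Measure (RN N)) : Prop :=
  (∀ᵐ x ∂μ, f x ≠ ⊤ ∧ f x ≠ ⊥) ∧ Integrable (fun x => (f x).toReal) μ

/-- An extended-real valued function belongs to `L¹_loc(Ω, μ)`. -/
def Fin1loc {N : ℕ} (Ω : Set (RN N)) (f : RN N → EReal) (μ : Measure (RN N)) : Prop :=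
  ∀ K : Set (RN N), IsCompact K → K ⊆ Ω →
    (∀ᵐ x ∂μ.restrict K, f x ≠ ⊤ ∧ f x ≠ ⊥) ∧
    IntegrableOn (fun x => (f x).toReal) K μ

/-- The `λ`-pairing distribution `⟨(A,Du)_λ, φ⟩`. -/
def pairing {N : ℕ} {Ω : Set (RN N)} (A : Fin N → LocM N Ω) (σ : LocM N Ω)
    (u lam : RN N → ℝ) (φ : RN N → ℝ) : ℝ :=
  - σ.intg (fun x => (lrep u lam x).toReal * φ x)
  - ∑ i, (A i).intg (fun x => (lrep u lam x).toReal * gradComp φ i x)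

/-- `u ∈ X_loc^{A,λ}(Ω)`. -/
def XlocMem {N : ℕ} {Ω : Set (RN N)} (A : Fin N → LocM N Ω) (σ : LocM N Ω)
    (u lam : RN N → ℝ) : Prop :=
  Fin1loc Ω (lrep u lam) (varSum A) ∧ Fin1loc Ω (lrep u lam) σ.var

/-- `χ_E^λ = χ_{E¹} + λ χ_{∂*E}`. -/
def chiLam {N : ℕ} (E : Set (RN N)) (lam : RN N → ℝ) (x : RN N) : ℝ :=
  (densOne E).indicator (fun _ => (1:ℝ)) x + lam x * (essBdry E).indicator (fun _ => (1:ℝ)) x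

/-- The `λ`-pairing distribution `⟨(A,Dχ_E)_λ, φ⟩`. -/
def pairingSet {N : ℕ} {Ω : Set (RN N)} (A : Fin N → LocM N Ω) (σ : LocM N Ω)
    (E : Set (RN N)) (lam : RN N → ℝ) (φ : RN N → ℝ) : ℝ :=
  - σ.intg (fun x => chiLam E lam x * φ x)
  - ∑ i, (A i).intg (fun x => chiLam E lam x * gradComp φ i x)

/-- The support of a (nonnegative) measure. -/
def msupp {N : ℕ} (μ : Measure (RN N)) : Set (RN N) := {x | ∀ U ∈ 𝓝 x, μ U ≠ 0}

/-- The measure `|A|·L^N` of a density field `a`. -/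
def vmeas {N : ℕ} (Ω : Set (RN N)) (a : RN N → RN N) : Measure (RN N) :=
  (volume.restrict Ω).withDensity (fun x => (‖a x‖₊ : ℝ≥0∞))

/-- `σ` is the distributional divergence on `Ω` of the `L¹_loc` field `a`. -/
def IsDivergenceD {N : ℕ} (Ω : Set (RN N)) (a : RN N → RN N) (σ : LocM N Ω) : Prop :=
  ∀ φ : RN N → ℝ, IsTest Ω φ → σ.intg φ = - ∫ x in Ω, fderiv ℝ φ x (a x)

/-- The `λ`-pairing for a density field `a`. -/
def pairingD {N : ℕ} (Ω : Set (RN N)) (a : RN N → RN N) (σ : LocM N Ω)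
    (u lam φ : RN N → ℝ) : ℝ :=
  - σ.intg (fun x => (lrep u lam x).toReal * φ x)
  - ∫ x in Ω, (lrep u lam x).toReal * fderiv ℝ φ x (a x)

/-- The set `λ`-pairing for a density field `a`. -/
def pairingSetD {N : ℕ} (Ω : Set (RN N)) (a : RN N → RN N) (σ : LocM N Ω)
    (E : Set (RN N)) (lam φ : RN N → ℝ) : ℝ :=
  - σ.intg (fun x => chiLam E lam x * φ x)
  - ∫ x in Ω, chiLam E lam x * fderiv ℝ φ x (a x)

/-- `u ∈ X_loc^{A,λ}(Ω)` for a density field. -/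
def XlocMemD {N : ℕ} (Ω : Set (RN N)) (a : RN N → RN N) (σ : LocM N Ω)
    (u lam : RN N → ℝ) : Prop :=
  Fin1loc Ω (lrep u lam) (vmeas Ω a) ∧ Fin1loc Ω (lrep u lam) σ.var

/-- `u ∈ BV_loc^{A,λ}(Ω)` for a density field. -/
def BVlocD {N : ℕ} (Ω : Set (RN N)) (a : RN N → RN N) (σ : LocM N Ω)
    (u lam : RN N → ℝ) : Prop :=
  XlocMemD Ω a σ u lam ∧
  ∃ μ : LocM N Ω, ∀ φ, IsTest Ω φ → pairingD Ω a σ u lam φ = μ.intg φ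

/-- A set that misses a neighbourhood of `x` has density `0` at `x`. -/
theorem hasDensity_zero_of_eventually_notMem {N : ℕ} {E : Set (RN N)} {x : RN N}
    (h : ∀ᶠ y in 𝓝 x, y ∉ E) : hasDensity E x 0 := by
  obtain ⟨ε, hε, hball⟩ := Metric.eventually_nhds_iff_ball.1 h
  refine tendsto_const_nhds.congr' ?_
  filter_upwards [Ioo_mem_nhdsGT hε] with r hr
  have hE : E ∩ ball x r = ∅ :=
    eq_empty_of_forall_notMem fun y hy => hball y (ball_subset_ball hr.2.le hy.2) hy.1
  simp [hE]

/-- A neighbourhood of `x` does not have density `0` at `x`. -/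
theorem not_hasDensity_zero_of_eventually_mem {N : ℕ} {E : Set (RN N)} {x : RN N}
    (h : ∀ᶠ y in 𝓝 x, y ∈ E) : ¬ hasDensity E x 0 := by
  obtain ⟨ε, hε, hball⟩ := Metric.eventually_nhds_iff_ball.1 h
  intro h0
  refine one_ne_zero (tendsto_nhds_unique (tendsto_const_nhds.congr' ?_) h0)
  filter_upwards [Ioo_mem_nhdsGT hε] with r hr
  have hE : E ∩ ball x r = ball x r :=
    inter_eq_right.2 fun y hy => hball y (ball_subset_ball hr.2.le hy)
  rw [hE, div_self]
  exact (ENNReal.toReal_pos (measure_ball_pos volume x hr.1).ne' measure_ball_lt_top.ne).ne'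

theorem aliminf_eq_zero_of_eventuallyEq {N : ℕ} {u : RN N → ℝ} {x : RN N} (h : u =ᶠ[𝓝 x] 0) :
    aliminf u x = 0 := by
  have hset : {t : EReal | hasDensity {y | ((u y : EReal)) < t} x 0} = Iic 0 := by
    ext t
    refine ⟨fun ht => ?_, fun ht => ?_⟩
    · by_contra hlt
      refine not_hasDensity_zero_of_eventually_mem ?_ ht
      filter_upwards [h] with y hy
      simpa [hy] using hlt
    · refine hasDensity_zero_of_eventually_notMem ?_
      filter_upwards [h] with y hy
      simpa [hy] using ht
  rw [aliminf, hset, csSup_Iic]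

theorem alimsup_eq_zero_of_eventuallyEq {N : ℕ} {u : RN N → ℝ} {x : RN N} (h : u =ᶠ[𝓝 x] 0) :
    alimsup u x = 0 := by
  have hset : {t : EReal | hasDensity {y | t < ((u y : EReal))} x 0} = Ici 0 := by
    ext t
    refine ⟨fun ht => ?_, fun ht => ?_⟩
    · by_contra hlt
      refine not_hasDensity_zero_of_eventually_mem ?_ ht
      filter_upwards [h] with y hy
      simpa [hy] using hlt
    · refine hasDensity_zero_of_eventually_notMem ?_
      filter_upwards [h] with y hy
      simpa [hy] using ht
  rw [alimsup, hset, csInf_Ici]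

/-- The `λ`-representative vanishes off the support. -/
theorem lrep_eq_zero_of_notMem_tsupport {N : ℕ} {u : RN N → ℝ} (lam : RN N → ℝ) {x : RN N}
    (hx : x ∉ tsupport u) : lrep u lam x = 0 := by
  have h := notMem_tsupport_iff_eventuallyEq.1 hx
  simp [lrep, aliminf_eq_zero_of_eventuallyEq h, alimsup_eq_zero_of_eventuallyEq h]

/-- An open set carries `[0,1]`-valued test functions equal to `1` near a given compact subset. -/
theorem exists_isTest_eq_one_nhdsSet {N : ℕ} {Ω K : Set (RN N)} (hΩ : IsOpen Ω)
    (hK : IsCompact K) (hKΩ : K ⊆ Ω) :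
    ∃ φ : RN N → ℝ, IsTest Ω φ ∧ (∀ᶠ x in 𝓝ˢ K, φ x = 1) ∧ ∀ x, φ x ∈ Icc (0 : ℝ) 1 := by
  obtain ⟨L, hL, hKL, hLΩ⟩ := exists_compact_between hK hΩ hKΩ
  obtain ⟨f, hf1, hf0, hf⟩ := exists_contMDiffMap_one_nhds_of_subset_interior
    (modelWithCornersSelf ℝ (RN N)) (n := (⊤ : ℕ∞)) hK.isClosed hKL
  have hsupp : tsupport f ⊆ L :=
    closure_minimal (fun x hx => by_contra fun hxL => hx (hf0 x hxL)) hL.isClosed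
  exact ⟨f, ⟨f.contMDiff.contDiff, hL.of_isClosed_subset (isClosed_tsupport _) hsupp,
    hsupp.trans hLΩ⟩, hf1, hf⟩

/-- Against a cutoff equal to `1` near the support of `u`, the pairing reduces to
`-∫ u^λ d(div A)`. -/
theorem pairing_eq_neg_intg_of_eq_one {N : ℕ} {Ω : Set (RN N)} (A : Fin N → LocM N Ω)
    (σ : LocM N Ω) (u lam : RN N → ℝ) {φ : RN N → ℝ}
    (hφ : ∀ᶠ x in 𝓝ˢ (tsupport u), φ x = 1) :
    pairing A σ u lam φ = - σ.intg (fun x => (lrep u lam x).toReal) := by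
  have hone : (fun x => (lrep u lam x).toReal * φ x) = fun x => (lrep u lam x).toReal := by
    funext x
    by_cases hx : x ∈ tsupport u
    · rw [hφ.self_of_nhdsSet x hx, mul_one]
    · simp [lrep_eq_zero_of_notMem_tsupport lam hx]
  have hgrad : ∀ i, (fun x => (lrep u lam x).toReal * gradComp φ i x) = fun _ => 0 := by
    intro i
    funext x
    by_cases hx : x ∈ tsupport u
    · have hev : φ =ᶠ[𝓝 x] fun _ => 1 := eventually_nhdsSet_iff_forall.1 hφ x hx
      simp [gradComp, hev.fderiv_eq]
    · simp [lrep_eq_zero_of_notMem_tsupport lam hx]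
  simp [pairing, hone, hgrad, LocM.intg]

/-- Integrals of cutoffs converging to `1` on `Ω` converge to the value of the measure on `Ω`. -/
theorem FM.tendsto_intg_rval {N : ℕ} {Ω : Set (RN N)} (μ : FM N Ω) {φ : ℕ → RN N → ℝ}
    (hc : ∀ n, Continuous (φ n)) (hb : ∀ n x, φ n x ∈ Icc (0 : ℝ) 1)
    (hlim : ∀ x ∈ Ω, Tendsto (fun n => φ n x) atTop (𝓝 1)) :
    Tendsto (fun n => μ.intg (φ n)) atTop (𝓝 (μ.rval Ω)) := by
  have key : ∀ ν : Measure (RN N), IsFiniteMeasure ν → ν Ωᶜ = 0 →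
      Tendsto (fun n => ∫ x, φ n x ∂ν) atTop (𝓝 (ν Ω).toReal) := by
    intro ν _ hν
    have hae : ∀ᵐ x ∂ν, x ∈ Ω := hν
    have huniv : (ν Ω).toReal = ∫ _, (1 : ℝ) ∂ν := by
      rw [measure_eq_measure_of_null_sdiff (subset_univ Ω) (by rwa [← compl_eq_univ_sdiff])]
      simp [Measure.real]
    rw [huniv]
    refine tendsto_integral_of_dominated_convergence (fun _ => 1)
      (fun n => (hc n).aestronglyMeasurable) (integrable_const _)
      (fun n => .of_forall fun x => ?_) (hae.mono hlim)
    rw [Real.norm_of_nonneg (hb n x).1]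
    exact (hb n x).2
  exact (key _ μ.posFin μ.posNull).sub (key _ μ.negFin μ.negNull)

/-- integration by parts for compactly supported `u ∈ BV^{A,λ}(Ω)`:
`∫_Ω u^λ d(div A) = -(A,Du)_λ(Ω)`. -/
theorem stmt5 {N : ℕ} (Ω : Set (RN N)) (hΩ : IsOpen Ω)
    (A : Fin N → LocM N Ω) (σ : LocM N Ω) (hdiv : IsDivergence Ω A σ)
    (lam : RN N → ℝ) (hlam : IsLam lam)
    (u : RN N → ℝ) (hu : Measurable u)
    (hmem : Fin1 (lrep u lam) (varSum A) ∧ Fin1 (lrep u lam) σ.var)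
    (μ : FM N Ω) (hμ : ∀ φ, IsTest Ω φ → pairing A σ u lam φ = μ.intg φ)
    (hcpt : IsCompact (tsupport u)) (hsub : tsupport u ⊆ Ω) :
    σ.intg (fun x => (lrep u lam x).toReal) = - μ.rval Ω := by
  have := hΩ.locallyCompactSpace
  let C : CompactExhaustion Ω := default
  have hC : ∀ n, IsCompact ((↑) '' C n : Set (RN N)) := fun n =>
    (C.isCompact n).image continuous_subtype_val
  choose φ hφ hone hIcc using fun n => exists_isTest_eq_one_nhdsSet hΩ (hcpt.union (hC n))
    (union_subset hsub (Subtype.coe_image_subset Ω (C n)))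
  have hlim := μ.tendsto_intg_rval (fun n => (hφ n).1.continuous) hIcc fun x hx => by
    obtain ⟨m, hm⟩ := C.exists_mem ⟨x, hx⟩
    refine tendsto_const_nhds.congr' ?_
    filter_upwards [eventually_ge_atTop m] with n hn
    exact ((hone n).self_of_nhdsSet x (.inr ⟨_, C.subset hn hm, rfl⟩)).symm
  have hconst : ∀ n, μ.intg (φ n) = - σ.intg (fun x => (lrep u lam x).toReal) := fun n => by
    rw [← hμ _ (hφ n)]
    exact pairing_eq_neg_intg_of_eq_one A σ u lam
      ((hone n).filter_mono (nhdsSet_mono subset_union_left))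
  simp only [hconst] at hlim
  rw [← tendsto_nhds_unique tendsto_const_nhds hlim, neg_neg]
end
end

section
/- (Coarea inequality for λ-pairings.) Let A ∈ DM_loc(Ω), λ : Ω → [0,1] Borel, and u ∈ BV_loc^{A,λ}(Ω) such that λu⁺ and (1-λ)u⁻ belong to L¹_loc(Ω,|A|) ∩ L¹_loc(Ω,|div A|), and such that |A|(N_t) + |div A|(N_t) = 0 for L¹-a.e. t ∈ ℝ, where N_t := {u⁻ ≤ t < u⁺} \ {u > t}^{1/2}. Then for all φ ∈ C_c^1(Ω), ∫_Ω φ d(A, Du)_λ = ∫_{-∞}^{+∞} ⟨(A, Dχ_{\{u>t\}})_λ, φ⟩ dt. -/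
open MeasureTheory Filter Topology Metric Set ENNReal NNReal

noncomputable section

/-- The set `N_t = {u⁻ ≤ t < u⁺} \ {u > t}^{1/2}`. -/
def coareaN {N : ℕ} (u : RN N → ℝ) (t : ℝ) : Set (RN N) :=
  {y | aliminf u y ≤ (t : EReal) ∧ (t : EReal) < alimsup u y} \
    {y | hasDensity {z | t < u z} y (1/2)}

lemma hasDensity_zero_mono {N : ℕ} {E F : Set (RN N)} {x : RN N} (h : E ⊆ F)
    (hF : hasDensity F x 0) : hasDensity E x 0 := by
  refine tendsto_of_tendsto_of_tendsto_of_le_of_le tendsto_const_nhds hF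
    (fun r => by positivity) (fun r => ?_)
  have : volume (F ∩ ball x r) ≠ ⊤ :=
    (measure_mono inter_subset_right |>.trans_lt measure_ball_lt_top).ne
  dsimp only
  gcongr

lemma hasDensity_compl_iff {N : ℕ} {E : Set (RN N)} (hE : MeasurableSet E) {x : RN N} :
    hasDensity Eᶜ x 0 ↔ hasDensity E x 1 := by
  have key : ∀ r : ℝ, 0 < r →
      (volume (Eᶜ ∩ ball x r)).toReal / (volume (ball x r)).toReal =
        1 - (volume (E ∩ ball x r)).toReal / (volume (ball x r)).toReal := by
    intro r hr
    have hb : (volume (ball x r)).toReal ≠ 0 :=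
      (ENNReal.toReal_pos (measure_ball_pos volume x hr).ne' measure_ball_lt_top.ne).ne'
    have hsum : (volume (E ∩ ball x r)).toReal + (volume (Eᶜ ∩ ball x r)).toReal =
        (volume (ball x r)).toReal := by
      rw [← ENNReal.toReal_add, inter_comm E, inter_comm Eᶜ, ← Set.sdiff_eq,
        measure_inter_add_sdiff _ hE]
      · exact (measure_mono inter_subset_right |>.trans_lt measure_ball_lt_top).ne
      · exact (measure_mono inter_subset_right |>.trans_lt measure_ball_lt_top).ne
    field_simp
    linarith
  unfold hasDensity
  constructor
  · intro h
    have h' : Tendsto (fun r : ℝ =>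
        1 - (volume (Eᶜ ∩ ball x r)).toReal / (volume (ball x r)).toReal)
        (𝓝[>] 0) (𝓝 1) := by simpa using h.const_sub 1
    refine h'.congr' ?_
    filter_upwards [self_mem_nhdsWithin] with r hr
    rw [key r hr]; ring
  · intro h
    have h' : Tendsto (fun r : ℝ =>
        1 - (volume (E ∩ ball x r)).toReal / (volume (ball x r)).toReal)
        (𝓝[>] 0) (𝓝 0) := by simpa using h.const_sub 1
    refine h'.congr' ?_
    filter_upwards [self_mem_nhdsWithin] with r hr
    rw [key r hr]

section LevelSets

variable {N : ℕ} {u : RN N → ℝ} {x : RN N} {t : ℝ}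

lemma alimsup_le_of_hasDensity (h : hasDensity {z | t < u z} x 0) : alimsup u x ≤ t := by
  refine sInf_le ?_
  simpa using h

lemma hasDensity_zero_of_alimsup_lt (h : alimsup u x < t) : hasDensity {z | t < u z} x 0 := by
  obtain ⟨s, hs, hst⟩ := sInf_lt_iff.1 h
  exact hasDensity_zero_mono (fun y (hy : t < u y) => hst.trans (EReal.coe_lt_coe_iff.2 hy)) hs

lemma le_aliminf_of_hasDensity (hu : Measurable u) (h : hasDensity {z | t < u z} x 1) :
    t ≤ aliminf u x := by
  refine le_sSup ?_
  have := (hasDensity_compl_iff (measurableSet_lt measurable_const hu)).2 h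
  refine hasDensity_zero_mono (fun y hy => ?_) this
  have hy' : u y < t := by simpa using hy
  simpa using hy'.le

lemma hasDensity_one_of_lt_aliminf (hu : Measurable u) (h : t < aliminf u x) :
    hasDensity {z | t < u z} x 1 := by
  obtain ⟨s, hs, hst⟩ := lt_sSup_iff.1 h
  refine (hasDensity_compl_iff (measurableSet_lt measurable_const hu)).1 ?_
  refine hasDensity_zero_mono (fun y hy => ?_) hs
  have hy' : u y ≤ t := by simpa using hy
  exact (EReal.coe_le_coe_iff.2 hy').trans_lt hst

/-- The level-set identity for `χ_{u > t}^λ`, away from the two levels `u⁻(x)` and `u⁺(x)`. -/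
lemma chiLam_superlevel (hu : Measurable u) {lam : RN N → ℝ} {a b : ℝ}
    (ha : 1 - lam x = 0 ∨ aliminf u x = a) (hb : lam x = 0 ∨ alimsup u x = b)
    (hta : t ≠ a) (htb : t ≠ b) :
    chiLam {z | t < u z} lam x =
      (1 - lam x) * (if t < a then 1 else 0) + lam x * (if t < b then 1 else 0) := by
  classical
  have h01 : ¬ (hasDensity {z | t < u z} x 0 ∧ hasDensity {z | t < u z} x 1) :=
    fun h => zero_ne_one (tendsto_nhds_unique h.1 h.2)
  have A1 : aliminf u x = a → t < a → hasDensity {z | t < u z} x 1 := fun h h' =>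
    hasDensity_one_of_lt_aliminf hu (by rw [h]; exact_mod_cast h')
  have A2 : aliminf u x = a → a < t → ¬ hasDensity {z | t < u z} x 1 := fun h h' hd => by
    have := le_aliminf_of_hasDensity hu hd
    rw [h, EReal.coe_le_coe_iff] at this
    linarith
  have B1 : alimsup u x = b → t < b → ¬ hasDensity {z | t < u z} x 0 := fun h h' hd => by
    have := alimsup_le_of_hasDensity hd
    rw [h, EReal.coe_le_coe_iff] at this
    linarith
  have B2 : alimsup u x = b → b < t → hasDensity {z | t < u z} x 0 := fun h h' =>
    hasDensity_zero_of_alimsup_lt (by rw [h]; exact_mod_cast h')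
  have hchi : chiLam {z | t < u z} lam x =
      if hasDensity {z | t < u z} x 1 then 1 else
        if hasDensity {z | t < u z} x 0 then 0 else lam x := by
    simp only [chiLam, densOne, essBdry, indicator, mem_ofPred_eq]
    by_cases h1 : hasDensity {z | t < u z} x 1 <;> by_cases h0 : hasDensity {z | t < u z} x 0 <;>
      simp [h0, h1]
  rw [hchi]
  rcases lt_or_gt_of_ne hta with h1 | h1 <;> rcases lt_or_gt_of_ne htb with h2 | h2 <;>
    simp only [h1, h2, not_lt_of_gt, if_true, if_false]
  · rcases ha with ha | ha
    · rcases hb with hb | hb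
      · linarith
      · rw [if_neg (B1 hb h2)]; split_ifs <;> linarith
    · rw [if_pos (A1 ha h1)]; ring
  · rcases ha with ha | ha
    · rcases hb with hb | hb
      · linarith
      · have := B2 hb h2
        rw [if_neg (fun h => h01 ⟨this, h⟩), if_pos this]; linarith
    · rcases hb with hb | hb
      · rw [if_pos (A1 ha h1)]; linarith
      · exact absurd ⟨B2 hb h2, A1 ha h1⟩ h01
  · rcases ha with ha | ha
    · rcases hb with hb | hb
      · linarith
      · rw [if_neg (B1 hb h2)]; split_ifs <;> linarith
    · rw [if_neg (A2 ha h1)]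
      rcases hb with hb | hb
      · split_ifs <;> linarith
      · rw [if_neg (B1 hb h2)]; ring
  · rcases ha with ha | ha
    · rcases hb with hb | hb
      · linarith
      · have := B2 hb h2
        rw [if_neg (fun h => h01 ⟨this, h⟩), if_pos this]; ring
    · rw [if_neg (A2 ha h1)]
      rcases hb with hb | hb
      · split_ifs <;> linarith
      · rw [if_pos (B2 hb h2)]; ring

end LevelSets

/-- The jump of the indicator of a half-line between levels `0` and `a`, whose integral is `a`. -/
def layer (a t : ℝ) : ℝ := (if t < a then 1 else 0) - (if t < 0 then 1 else 0)

lemma layer_of_nonneg {a : ℝ} (ha : 0 ≤ a) : layer a = (Ico 0 a).indicator (fun _ => 1) := by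
  ext t
  simp only [layer, indicator, mem_Ico]
  split_ifs <;> grind

lemma layer_of_neg {a : ℝ} (ha : a < 0) : layer a = (Ico a 0).indicator (fun _ => -1) := by
  ext t
  simp only [layer, indicator, mem_Ico]
  split_ifs <;> grind

lemma integrable_layer (a : ℝ) : Integrable (layer a) := by
  rcases le_or_gt 0 a with ha | ha
  · rw [layer_of_nonneg ha]
    exact (integrableOn_const (by simp)).integrable_indicator measurableSet_Ico
  · rw [layer_of_neg ha]
    exact (integrableOn_const (by simp)).integrable_indicator measurableSet_Ico

lemma integral_layer (a : ℝ) : ∫ t, layer a t = a := by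
  rcases le_or_gt 0 a with ha | ha
  · rw [layer_of_nonneg ha, integral_indicator measurableSet_Ico]
    simp [ha]
  · rw [layer_of_neg ha, integral_indicator measurableSet_Ico]
    simp [ha.le]

lemma integral_abs_layer (a : ℝ) : ∫ t, |layer a t| = |a| := by
  rcases le_or_gt 0 a with ha | ha
  · rw [abs_of_nonneg ha]
    nth_rewrite 2 [← integral_layer a]
    refine integral_congr_ae (Eventually.of_forall fun t => abs_of_nonneg ?_)
    rw [layer_of_nonneg ha]
    exact indicator_nonneg (fun _ _ => zero_le_one) t
  · rw [abs_of_neg ha]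
    nth_rewrite 2 [← integral_layer a]
    rw [← integral_neg]
    refine integral_congr_ae (Eventually.of_forall fun t => abs_of_nonpos ?_)
    rw [layer_of_neg ha]
    exact indicator_nonpos (fun _ _ => by norm_num) t

lemma measurable_layer : Measurable (fun p : ℝ × ℝ => layer p.1 p.2) := by
  refine Measurable.sub ?_ ?_
  · exact Measurable.ite (measurableSet_lt measurable_snd measurable_fst) measurable_const
      measurable_const
  · exact Measurable.ite (measurableSet_lt measurable_snd measurable_const) measurable_const
      measurable_const

section Fubini

variable {X : Type*} [MeasurableSpace X] {m : Measure X}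
  {q α ψ : X → ℝ} {C : ℝ}

lemma integrable_layer_prod (hq : Measurable q) (hα : Measurable α) (hαi : Integrable α m)
    (h0 : ∀ᵐ x ∂m, q x = 0 → α x = 0) (hψ : Measurable ψ) (hC : ∀ x, |ψ x| ≤ C) :
    Integrable (fun p : X × ℝ => q p.1 * layer (α p.1 / q p.1) p.2 * ψ p.1)
      (m.prod volume) := by
  have hmeas : Measurable (fun p : X × ℝ => q p.1 * layer (α p.1 / q p.1) p.2 * ψ p.1) := by
    have : Measurable (fun p : X × ℝ => layer (α p.1 / q p.1) p.2) :=
      measurable_layer.comp (Measurable.prodMk (by fun_prop) measurable_snd)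
    fun_prop
  rw [integrable_prod_iff hmeas.aestronglyMeasurable]
  refine ⟨Eventually.of_forall fun x =>
    ((integrable_layer (α x / q x)).const_mul (q x)).mul_const (ψ x), ?_⟩
  have hαψ : Integrable (fun x => |α x| * |ψ x|) m :=
    hαi.abs.mul_bdd (c := C) hψ.abs.aestronglyMeasurable
      (Eventually.of_forall fun x => by simpa using hC x)
  refine hαψ.congr ?_
  filter_upwards [h0] with x hx
  simp only [norm_mul, Real.norm_eq_abs, integral_const_mul, integral_mul_const,
    integral_abs_layer]
  by_cases hqx : q x = 0
  · simp [hqx, hx hqx]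
  · rw [← abs_mul (q x), mul_div_cancel₀ _ hqx]

lemma integral_layer_prod [SFinite m] (hq : Measurable q) (hα : Measurable α) (hαi : Integrable α m)
    (h0 : ∀ᵐ x ∂m, q x = 0 → α x = 0) (hψ : Measurable ψ) (hC : ∀ x, |ψ x| ≤ C) :
    ∫ t, ∫ x, q x * layer (α x / q x) t * ψ x ∂m = ∫ x, α x * ψ x ∂m := by
  rw [← integral_integral_swap (f := fun x t => q x * layer (α x / q x) t * ψ x)
    (integrable_layer_prod hq hα hαi h0 hψ hC)]
  refine integral_congr_ae ?_
  filter_upwards [h0] with x hx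
  simp only [integral_const_mul, integral_mul_const, integral_layer]
  by_cases hqx : q x = 0
  · simp [hqx, hx hqx]
  · rw [mul_div_cancel₀ _ hqx]

lemma ae_ae_ne [SFinite m] {g : X → ℝ} (hg : Measurable g) :
    ∀ᵐ t : ℝ, ∀ᵐ x ∂m, t ≠ g x := by
  have hc : Set.Countable {t : ℝ | 0 < m {a | g a = t}} :=
    Measure.countable_meas_level_set_pos hg
  filter_upwards [hc.ae_notMem volume] with t ht
  have : m {a | g a = t} = 0 := by simpa using ht
  rw [ae_iff]
  convert this using 3
  simp [eq_comm]

end Fubini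

lemma eq_toReal_div {N : ℕ} (f : RN N → EReal) {q : ℝ} {x : RN N}
    (h : (q : EReal) * f x ≠ ⊤ ∧ (q : EReal) * f x ≠ ⊥) :
    (q = 0 → ((q : EReal) * f x).toReal = 0) ∧
      (q = 0 ∨ f x = ((((q : EReal) * f x).toReal / q : ℝ) : EReal)) := by
  refine ⟨fun hq => by simp [hq], or_iff_not_imp_left.2 fun hq => ?_⟩
  induction hf : f x with
  | bot =>
    rw [hf] at h
    rcases lt_or_gt_of_ne hq with hq | hq
    · exact absurd (EReal.coe_mul_bot_of_neg hq) h.1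
    · exact absurd (EReal.coe_mul_bot_of_pos hq) h.2
  | top =>
    rw [hf] at h
    rcases lt_or_gt_of_ne hq with hq | hq
    · exact absurd (EReal.coe_mul_top_of_neg hq) h.2
    · exact absurd (EReal.coe_mul_top_of_pos hq) h.1
  | coe r =>
    rw [← EReal.coe_mul, EReal.toReal_coe, mul_div_cancel_left₀ _ hq]

lemma toReal_lrep {N : ℕ} {u lam : RN N → ℝ} {x : RN N}
    (h₁ : ((lam x : ℝ) : EReal) * alimsup u x ≠ ⊤ ∧ ((lam x : ℝ) : EReal) * alimsup u x ≠ ⊥)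
    (h₂ : ((1 - lam x : ℝ) : EReal) * aliminf u x ≠ ⊤ ∧
      ((1 - lam x : ℝ) : EReal) * aliminf u x ≠ ⊥) :
    (lrep u lam x).toReal = (((1 - lam x : ℝ) : EReal) * aliminf u x).toReal +
      (((lam x : ℝ) : EReal) * alimsup u x).toReal := by
  have hZ : ¬ (alimsup u x = ⊤ ∧ aliminf u x = ⊥) := by
    rintro ⟨hP, hM⟩
    rcases (eq_toReal_div _ h₁).2 with h | h
    · rcases (eq_toReal_div _ h₂).2 with h' | h'
      · linarith
      · exact EReal.coe_ne_bot _ (h'.symm.trans hM)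
    · exact EReal.coe_ne_top _ (h.symm.trans hP)
  rw [lrep, if_neg hZ, EReal.toReal_add h₂.1 h₂.2 h₁.1 h₁.2]

/-- Coarea formula for a single finite measure, up to the term `∫ ψ` on negative levels, which
makes the levels integrable. -/
lemma exists_coarea_of_isFiniteMeasure {N : ℕ} {m : Measure (RN N)} [IsFiniteMeasure m]
    {u lam ψ : RN N → ℝ} {C : ℝ} (hu : Measurable u) (hlam : Measurable lam)
    (h₁ : Fin1 (fun x => ((lam x : ℝ) : EReal) * alimsup u x) m)
    (h₂ : Fin1 (fun x => ((1 - lam x : ℝ) : EReal) * aliminf u x) m)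
    (hψ : Measurable ψ) (hC : ∀ x, |ψ x| ≤ C) :
    ∃ H : ℝ → ℝ, Integrable H ∧
      (∀ᵐ t, ∫ x, chiLam {z | t < u z} lam x * ψ x ∂m =
        H t + (if t < 0 then 1 else 0) * ∫ x, ψ x ∂m) ∧
      ∫ t, H t = ∫ x, (lrep u lam x).toReal * ψ x ∂m := by
  obtain ⟨f₁, i₁⟩ := h₁
  obtain ⟨f₂, i₂⟩ := h₂
  obtain ⟨α, sα, eα⟩ := i₂.1
  obtain ⟨β, sβ, eβ⟩ := i₁.1
  have mα := sα.measurable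
  have mβ := sβ.measurable
  have iα : Integrable α m := i₂.congr eα
  have iβ : Integrable β m := i₁.congr eβ
  have mq : Measurable (fun x => 1 - lam x) := by fun_prop
  have α0 : ∀ᵐ x ∂m, 1 - lam x = 0 → α x = 0 := by
    filter_upwards [eα, f₂] with x hx hf h
    rw [← hx]; exact (eq_toReal_div _ hf).1 h
  have β0 : ∀ᵐ x ∂m, lam x = 0 → β x = 0 := by
    filter_upwards [eβ, f₁] with x hx hf h
    rw [← hx]; exact (eq_toReal_div _ hf).1 h
  have I₂ := integrable_layer_prod mq mα iα α0 hψ hC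
  have I₁ := integrable_layer_prod hlam mβ iβ β0 hψ hC
  have bψ : ∀ᵐ x ∂m, ‖ψ x‖ ≤ C := Eventually.of_forall hC
  have iψ : Integrable ψ m := Integrable.of_bound hψ.aestronglyMeasurable C bψ
  refine ⟨fun t => (∫ x, (1 - lam x) * layer (α x / (1 - lam x)) t * ψ x ∂m) +
    ∫ x, lam x * layer (β x / lam x) t * ψ x ∂m,
    I₂.integral_prod_right.add I₁.integral_prod_right, ?_, ?_⟩
  · filter_upwards [ae_ae_ne (m := m) (g := fun x => α x / (1 - lam x)) (by fun_prop),
      ae_ae_ne (m := m) (g := fun x => β x / lam x) (by fun_prop),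
      I₂.prod_left_ae, I₁.prod_left_ae] with t tα tβ It₂ It₁
    have It := It₂.add It₁
    simp only [Pi.add_def] at It
    rw [← integral_const_mul, ← integral_add It₂ It₁, ← integral_add It (iψ.const_mul _)]
    refine integral_congr_ae ?_
    filter_upwards [tα, tβ, eα, eβ, f₁, f₂] with x hx₁ hx₂ hxα hxβ hf₁ hf₂
    have l₁ := (eq_toReal_div _ hf₁).2
    have l₂ := (eq_toReal_div _ hf₂).2
    rw [hxβ] at l₁
    rw [hxα] at l₂
    rw [chiLam_superlevel hu l₂ l₁ hx₁ hx₂]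
    simp only [layer]
    ring
  · rw [integral_add I₂.integral_prod_right I₁.integral_prod_right,
      integral_layer_prod mq mα iα α0 hψ hC, integral_layer_prod hlam mβ iβ β0 hψ hC,
      ← integral_add (iα.mul_bdd hψ.aestronglyMeasurable bψ)
        (iβ.mul_bdd hψ.aestronglyMeasurable bψ)]
    refine integral_congr_ae ?_
    filter_upwards [eα, eβ, f₁, f₂] with x hxα hxβ hf₁ hf₂
    rw [toReal_lrep hf₁ hf₂, hxα, hxβ]
    ring

namespace LocM

variable {N : ℕ} {Ω : Set (RN N)}

lemma pos_le_var (ν : LocM N Ω) : ν.pos ≤ ν.var := Measure.le_add_right le_rfl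

lemma neg_le_var (ν : LocM N Ω) : ν.neg ≤ ν.var := Measure.le_add_left le_rfl

lemma measure_compact_lt_top {m : Measure (RN N)} (hm : ∀ x ∈ Ω, ∃ s ∈ 𝓝 x, m s < ⊤)
    {K : Set (RN N)} (hK : IsCompact K) (hKΩ : K ⊆ Ω) : m K < ⊤ :=
  hK.measure_lt_top_of_nhdsWithin fun x hx =>
    let ⟨s, hs, hlt⟩ := hm x (hKΩ hx)
    ⟨s, mem_nhdsWithin_of_mem_nhds hs, hlt⟩

end LocM

lemma Fin1loc.mono {N : ℕ} {Ω : Set (RN N)} {f : RN N → EReal} {m m' : Measure (RN N)}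
    (h : Fin1loc Ω f m) (hm : m' ≤ m) : Fin1loc Ω f m' := fun K hK hKΩ =>
  ⟨ae_mono (Measure.restrict_mono le_rfl hm) (h K hK hKΩ).1, (h K hK hKΩ).2.mono_measure hm⟩

lemma var_le_varSum {N : ℕ} {Ω : Set (RN N)} (A : Fin N → LocM N Ω) (i : Fin N) :
    (A i).var ≤ varSum A := by
  intro s
  rw [varSum, Measure.finsetSum_apply]
  exact Finset.single_le_sum (f := fun i => (A i).var s) (fun _ _ => zero_le)
    (Finset.mem_univ i)

lemma exists_coarea_of_isCompact {N : ℕ} {Ω : Set (RN N)} {m : Measure (RN N)}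
    (hm : ∀ x ∈ Ω, ∃ s ∈ 𝓝 x, m s < ⊤) {u lam ψ : RN N → ℝ} (hu : Measurable u)
    (hlam : Measurable lam)
    (h₁ : Fin1loc Ω (fun x => ((lam x : ℝ) : EReal) * alimsup u x) m)
    (h₂ : Fin1loc Ω (fun x => ((1 - lam x : ℝ) : EReal) * aliminf u x) m)
    {K : Set (RN N)} (hK : IsCompact K) (hKΩ : K ⊆ Ω)
    (hψ : Continuous ψ) (hψK : ∀ x ∉ K, ψ x = 0) :
    ∃ H : ℝ → ℝ, Integrable H ∧
      (∀ᵐ t, ∫ x, chiLam {z | t < u z} lam x * ψ x ∂m =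
        H t + (if t < 0 then 1 else 0) * ∫ x, ψ x ∂m) ∧
      ∫ t, H t = ∫ x, (lrep u lam x).toReal * ψ x ∂m := by
  have : IsFiniteMeasure (m.restrict K) :=
    isFiniteMeasure_restrict.2 (LocM.measure_compact_lt_top hm hK hKΩ).ne
  obtain ⟨C, hC⟩ := (HasCompactSupport.intro hK hψK).exists_bound_of_continuous hψ
  have key := exists_coarea_of_isFiniteMeasure (m := m.restrict K) hu hlam (h₁ K hK hKΩ)
    (h₂ K hK hKΩ) hψ.measurable hC
  have hr : ∀ w : RN N → ℝ, ∫ x in K, w x * ψ x ∂m = ∫ x, w x * ψ x ∂m := fun w =>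
    setIntegral_eq_integral_of_forall_compl_eq_zero fun x hx => by rw [hψK x hx, mul_zero]
  have hr' : ∫ x in K, ψ x ∂m = ∫ x, ψ x ∂m :=
    setIntegral_eq_integral_of_forall_compl_eq_zero hψK
  simpa only [hr, hr'] using key

lemma LocM.exists_coarea {N : ℕ} {Ω : Set (RN N)} (ν : LocM N Ω) {u lam ψ : RN N → ℝ}
    (hu : Measurable u) (hlam : Measurable lam)
    (h₁ : Fin1loc Ω (fun x => ((lam x : ℝ) : EReal) * alimsup u x) ν.var)
    (h₂ : Fin1loc Ω (fun x => ((1 - lam x : ℝ) : EReal) * aliminf u x) ν.var)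
    {K : Set (RN N)} (hK : IsCompact K) (hKΩ : K ⊆ Ω)
    (hψ : Continuous ψ) (hψK : ∀ x ∉ K, ψ x = 0) :
    ∃ H : ℝ → ℝ, Integrable H ∧
      (∀ᵐ t, ν.intg (fun x => chiLam {z | t < u z} lam x * ψ x) =
        H t + (if t < 0 then 1 else 0) * ν.intg ψ) ∧
      ∫ t, H t = ν.intg (fun x => (lrep u lam x).toReal * ψ x) := by
  obtain ⟨H, iH, eH, sH⟩ := exists_coarea_of_isCompact ν.posLoc hu hlam
    (h₁.mono ν.pos_le_var) (h₂.mono ν.pos_le_var) hK hKΩ hψ hψK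
  obtain ⟨G, iG, eG, sG⟩ := exists_coarea_of_isCompact ν.negLoc hu hlam
    (h₁.mono ν.neg_le_var) (h₂.mono ν.neg_le_var) hK hKΩ hψ hψK
  refine ⟨fun t => H t - G t, iH.sub iG, ?_, ?_⟩
  · filter_upwards [eH, eG] with t h g
    simp only [LocM.intg, h, g]
    ring
  · rw [integral_sub iH iG, sH, sG, LocM.intg]

open scoped Convolution in
/-- A `C¹` function with compact support is uniformly approximated in `C¹` by smooth functions. -/
lemma exists_smooth_approx {E : Type*} [NormedAddCommGroup E] [InnerProductSpace ℝ E]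
    [FiniteDimensional ℝ E] [MeasurableSpace E] [BorelSpace E] {φ : E → ℝ}
    (hφ : ContDiff ℝ 1 φ) (hc : HasCompactSupport φ) {δ ε : ℝ} (hδ : 0 < δ) (hε : 0 < ε) :
    ∃ η : E → ℝ, ContDiff ℝ (⊤ : ℕ∞) η ∧ Function.support η ⊆ cthickening δ (tsupport φ) ∧
      (∀ x, ‖η x - φ x‖ ≤ ε) ∧ ∀ x, ‖fderiv ℝ η x - fderiv ℝ φ x‖ ≤ ε := by
  have hφc : Continuous φ := hφ.continuous
  have hDc : Continuous (fderiv ℝ φ) := hφ.continuous_fderiv one_ne_zero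
  obtain ⟨r₁, hr₁, h₁⟩ := Metric.uniformContinuous_iff.1
    (hc.uniformContinuous_of_continuous hφc) ε hε
  obtain ⟨r₂, hr₂, h₂⟩ := Metric.uniformContinuous_iff.1
    ((hc.fderiv ℝ).uniformContinuous_of_continuous hDc) ε hε
  let r := min δ (min r₁ r₂)
  have hr0 : 0 < r := by positivity
  let b : ContDiffBump (0 : E) := ⟨r / 2, r, by positivity, by linarith⟩
  have hb : LocallyIntegrable (b.normed volume) volume :=
    b.continuous_normed.locallyIntegrable
  refine ⟨b.normed volume ⋆[ContinuousLinearMap.lsmul ℝ ℝ, volume] φ, ?_, ?_, fun x => ?_,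
    fun x => ?_⟩
  · exact b.hasCompactSupport_normed.contDiff_convolution_left _ b.contDiff_normed
      hφc.locallyIntegrable
  · refine (support_convolution_subset _).trans ?_
    rw [b.support_normed_eq]
    rintro _ ⟨y, hy, z, hz, rfl⟩
    refine mem_cthickening_of_dist_le _ z _ _ (subset_tsupport _ hz) ?_
    have : ‖y‖ < r := by simpa [b] using hy
    simpa using this.le.trans (min_le_left _ _)
  · rw [← dist_eq_norm]
    refine b.dist_normed_convolution_le hφc.aestronglyMeasurable fun y hy => (h₁ ?_).le
    exact (mem_ball.1 hy).trans_le ((min_le_right _ _).trans (min_le_left _ _))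
  · rw [(hc.hasFDerivAt_convolution_right _ hb hφ x).fderiv, ← dist_eq_norm]
    have : (b.normed volume ⋆[(ContinuousLinearMap.lsmul ℝ ℝ).precompR E, volume]
        fderiv ℝ φ) x =
        (b.normed volume ⋆[ContinuousLinearMap.lsmul ℝ ℝ, volume] fderiv ℝ φ) x := by
      rw [convolution_def, convolution_def]
      rfl
    rw [this]
    refine b.dist_normed_convolution_le hDc.aestronglyMeasurable fun y hy => (h₂ ?_).le
    exact (mem_ball.1 hy).trans_le ((min_le_right _ _).trans (min_le_right _ _))

lemma gradComp_eq_zero {N : ℕ} {φ : RN N → ℝ} {i : Fin N} {x : RN N} (hx : x ∉ tsupport φ) :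
    gradComp φ i x = 0 := by
  have : fderiv ℝ φ x = 0 := by
    by_contra h
    exact hx (support_fderiv_subset ℝ h)
  simp [gradComp, this]

lemma continuous_gradComp {N : ℕ} {φ : RN N → ℝ} (hφ : ContDiff ℝ 1 φ) (i : Fin N) :
    Continuous (gradComp φ i) :=
  (hφ.continuous_fderiv one_ne_zero).clm_apply continuous_const

/-- Uniform convergence, with supports in `K`. -/
structure UnifOn {N : ℕ} (K : Set (RN N)) (ψs : ℕ → RN N → ℝ) (ψ : RN N → ℝ) : Prop where
  continuous : ∀ n, Continuous (ψs n)
  zero : ∀ n, ∀ x ∉ K, ψs n x = 0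
  dist_le : ∀ n x, |ψs n x - ψ x| ≤ 1 / ((n : ℝ) + 1)

lemma exists_test_seq {N : ℕ} {Ω : Set (RN N)} (hΩ : IsOpen Ω) {φ : RN N → ℝ}
    (hφ : IsTest1 Ω φ) :
    ∃ K, IsCompact K ∧ K ⊆ Ω ∧ ∃ η : ℕ → RN N → ℝ, (∀ n, IsTest Ω (η n)) ∧
      UnifOn K η φ ∧ ∀ i, UnifOn K (fun n => gradComp (η n) i) (gradComp φ i) := by
  obtain ⟨h1, hc, hs⟩ := hφ
  obtain ⟨δ, hδ, hδΩ⟩ := hc.isCompact.exists_cthickening_subset_open hΩ hs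
  have hK : IsCompact (cthickening δ (tsupport φ)) := hc.isCompact.cthickening
  choose η hη hsupp hd hD using fun n : ℕ =>
    exists_smooth_approx h1 hc hδ (Nat.one_div_pos_of_nat (α := ℝ) (n := n))
  have hts : ∀ n, tsupport (η n) ⊆ cthickening δ (tsupport φ) := fun n =>
    closure_minimal (hsupp n) isClosed_cthickening
  have hη1 : ∀ n, ContDiff ℝ 1 (η n) := fun n => (hη n).of_le (by exact_mod_cast le_top)
  refine ⟨_, hK, hδΩ, η, fun n => ⟨hη n, hK.of_isClosed_subset (isClosed_tsupport _) (hts n),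
    (hts n).trans hδΩ⟩, ⟨fun n => (hη n).continuous, fun n x hx => ?_, hd⟩,
    fun i => ⟨fun n => continuous_gradComp (hη1 n) i, fun n x hx =>
      gradComp_eq_zero fun h => hx (hts n h), fun n x => ?_⟩⟩
  · exact image_eq_zero_of_notMem_tsupport fun h => hx (hts n h)
  · have := (fderiv ℝ (η n) x - fderiv ℝ φ x).le_opNorm (EuclideanSpace.single i (1 : ℝ))
    simp only [PiLp.norm_single, norm_one, mul_one] at this
    exact this.trans (hD n x)

lemma UnifOn.tendsto_integral {N : ℕ} {K : Set (RN N)} (hK : IsCompact K)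
    {ψs : ℕ → RN N → ℝ} {ψ : RN N → ℝ} (h : UnifOn K ψs ψ) {m : Measure (RN N)}
    {w : RN N → ℝ} (hw : IntegrableOn w K m) :
    Tendsto (fun n => ∫ x, w x * ψs n x ∂m) atTop (𝓝 (∫ x, w x * ψ x ∂m)) := by
  have hlim : ∀ x, Tendsto (fun n => ψs n x) atTop (𝓝 (ψ x)) := fun x => by
    rw [tendsto_iff_dist_tendsto_zero]
    exact squeeze_zero (fun _ => dist_nonneg) (fun n => h.dist_le n x)
      tendsto_one_div_add_atTop_nhds_zero_nat
  have hψK : ∀ x ∉ K, ψ x = 0 := fun x hx =>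
    tendsto_nhds_unique (hlim x) (by simp [h.zero _ x hx])
  have hr : ∀ f : RN N → ℝ, (∀ x ∉ K, f x = 0) →
      ∫ x in K, w x * f x ∂m = ∫ x, w x * f x ∂m := fun f hf =>
    setIntegral_eq_integral_of_forall_compl_eq_zero fun x hx => by rw [hf x hx, mul_zero]
  obtain ⟨C, hC⟩ := (HasCompactSupport.intro hK (h.zero 0)).exists_bound_of_continuous
    (h.continuous 0)
  have hbound : ∀ n x, |ψs n x| ≤ C + 2 := fun n x => by
    have h0 := h.dist_le 0 x
    have hn := h.dist_le n x
    have hn1 : 1 / ((n : ℝ) + 1) ≤ 1 := by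
      rw [div_le_one (by positivity)]
      linarith [n.cast_nonneg (α := ℝ)]
    have hC' := hC x
    rw [Real.norm_eq_abs] at hC'
    norm_num at h0
    rw [abs_le] at *
    constructor <;> linarith
  rw [← hr ψ hψK]
  simp_rw [← hr _ (h.zero _)]
  refine tendsto_integral_of_dominated_convergence (fun x => |w x| * (C + 2))
    (fun n => hw.1.mul (h.continuous n).aestronglyMeasurable) (hw.abs.mul_const _)
    (fun n => Eventually.of_forall fun x => ?_)
    (Eventually.of_forall fun x => (hlim x).const_mul _)
  rw [norm_mul]
  exact mul_le_mul_of_nonneg_left (hbound n x) (abs_nonneg _)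

lemma UnifOn.tendsto_intg {N : ℕ} {Ω K : Set (RN N)} (hK : IsCompact K)
    {ψs : ℕ → RN N → ℝ} {ψ : RN N → ℝ} (h : UnifOn K ψs ψ) (ν : LocM N Ω)
    {w : RN N → ℝ} (hw : IntegrableOn w K ν.var) :
    Tendsto (fun n => ν.intg fun x => w x * ψs n x) atTop (𝓝 (ν.intg fun x => w x * ψ x)) :=
  (h.tendsto_integral hK (hw.mono_measure ν.pos_le_var)).sub
    (h.tendsto_integral hK (hw.mono_measure ν.neg_le_var))

lemma UnifOn.tendsto_intg_one {N : ℕ} {Ω K : Set (RN N)} (hK : IsCompact K) (hKΩ : K ⊆ Ω)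
    {ψs : ℕ → RN N → ℝ} {ψ : RN N → ℝ} (h : UnifOn K ψs ψ) (ν : LocM N Ω) :
    Tendsto (fun n => ν.intg (ψs n)) atTop (𝓝 (ν.intg ψ)) := by
  have hfin : ν.var K < ⊤ := by
    rw [LocM.var, Measure.add_apply]
    exact ENNReal.add_lt_top.2 ⟨LocM.measure_compact_lt_top ν.posLoc hK hKΩ,
      LocM.measure_compact_lt_top ν.negLoc hK hKΩ⟩
  simpa using h.tendsto_intg hK ν (w := fun _ => 1) (integrableOn_const hfin.ne)

lemma IsDivergence.intg_eq {N : ℕ} {Ω : Set (RN N)} (hΩ : IsOpen Ω) {A : Fin N → LocM N Ω}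
    {σ : LocM N Ω} (h : IsDivergence Ω A σ) {φ : RN N → ℝ} (hφ : IsTest1 Ω φ) :
    σ.intg φ = - ∑ i, (A i).intg (gradComp φ i) := by
  obtain ⟨K, hK, hKΩ, η, hη, hu, hg⟩ := exists_test_seq hΩ hφ
  refine tendsto_nhds_unique (hu.tendsto_intg_one hK hKΩ σ) ?_
  simp_rw [fun n => h (η n) (hη n)]
  exact (tendsto_finsetSum _ fun i _ => (hg i).tendsto_intg_one hK hKΩ (A i)).neg

lemma pairing_eq_intg {N : ℕ} {Ω : Set (RN N)} (hΩ : IsOpen Ω) {A : Fin N → LocM N Ω}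
    {σ μ : LocM N Ω} {u lam : RN N → ℝ} (hX : XlocMem A σ u lam)
    (hμ : ∀ φ, IsTest Ω φ → pairing A σ u lam φ = μ.intg φ) {φ : RN N → ℝ}
    (hφ : IsTest1 Ω φ) : pairing A σ u lam φ = μ.intg φ := by
  obtain ⟨K, hK, hKΩ, η, hη, hu, hg⟩ := exists_test_seq hΩ hφ
  refine tendsto_nhds_unique ?_ (hu.tendsto_intg_one hK hKΩ μ)
  simp_rw [← fun n => hμ (η n) (hη n)]
  exact (hu.tendsto_intg hK σ (hX.2 K hK hKΩ).2).neg.sub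
    (tendsto_finsetSum _ fun i _ => (hg i).tendsto_intg hK (A i)
      (hX.1.mono (var_le_varSum A i) K hK hKΩ).2)

/-- coarea formula for the `λ`-pairing:
`∫_Ω φ d(A,Du)_λ = ∫_ℝ ⟨(A,Dχ_{u>t})_λ, φ⟩ dt`. -/
theorem stmt10 {N : ℕ} (Ω : Set (RN N)) (hΩ : IsOpen Ω)
    (A : Fin N → LocM N Ω) (σ : LocM N Ω) (hdiv : IsDivergence Ω A σ)
    (lam : RN N → ℝ) (hlam : IsLam lam)
    (u : RN N → ℝ) (hu : Measurable u)
    (hX : XlocMem A σ u lam)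
    (μ : LocM N Ω) (hμ : ∀ φ, IsTest Ω φ → pairing A σ u lam φ = μ.intg φ)
    (h1 : Fin1loc Ω (fun x => ((lam x : ℝ) : EReal) * alimsup u x) (varSum A) ∧
          Fin1loc Ω (fun x => ((lam x : ℝ) : EReal) * alimsup u x) σ.var)
    (h2 : Fin1loc Ω (fun x => ((1 - lam x : ℝ) : EReal) * aliminf u x) (varSum A) ∧
          Fin1loc Ω (fun x => ((1 - lam x : ℝ) : EReal) * aliminf u x) σ.var)
    (hN : ∀ᵐ t ∂(volume : Measure ℝ),
      varSum A (coareaN u t) = 0 ∧ σ.var (coareaN u t) = 0) :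
    ∀ φ, IsTest1 Ω φ →
      μ.intg φ = ∫ t : ℝ, pairingSet A σ {z | t < u z} lam φ := by
  intro φ hφ
  have hφ0 : ∀ x ∉ tsupport φ, φ x = 0 := fun x => image_eq_zero_of_notMem_tsupport
  obtain ⟨H, iH, eH, sH⟩ := σ.exists_coarea hu hlam.1 h1.2 h2.2 hφ.2.1.isCompact hφ.2.2
    hφ.1.continuous hφ0
  choose G iG eG sG using fun i => (A i).exists_coarea hu hlam.1
    (h1.1.mono (var_le_varSum A i)) (h2.1.mono (var_le_varSum A i)) hφ.2.1.isCompact hφ.2.2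
    (continuous_gradComp hφ.1 i) (fun x hx => gradComp_eq_zero hx)
  have hlevel : ∀ᵐ t, pairingSet A σ {z | t < u z} lam φ = - H t - ∑ i, G i t := by
    filter_upwards [eH, ae_all_iff.2 eG] with t hH hG
    rw [pairingSet, hH, Finset.sum_congr rfl fun i _ => hG i, Finset.sum_add_distrib,
      ← Finset.mul_sum, hdiv.intg_eq hΩ hφ]
    ring
  have iH' : Integrable (fun t => - H t) := iH.neg
  rw [integral_congr_ae hlevel, integral_sub iH' (integrable_finsetSum _ fun i _ => iG i),
    integral_neg, integral_finsetSum _ fun i _ => iG i, ← pairing_eq_intg hΩ hX hμ hφ, pairing,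
    sH, Finset.sum_congr rfl fun i _ => sG i]
end
end

section
/- Let A ∈ DM_loc(Ω), λ : Ω → [0,1] Borel, and E ⊂ Ω a Borel set. Then the distribution (A, Dχ_E)_λ is supported in ∂⁻E := {x : 0 < L^N(E ∩ B_r(x)) < L^N(B_r(x)) for all r > 0}. -/
open MeasureTheory Filter Topology Metric Set ENNReal NNReal

noncomputable section

/-- Uniform convergence of continuous functions vanishing outside a fixed compact set of finite
measure implies convergence of the integrals. -/
theorem tendsto_integral_of_uniform_of_compact {N : ℕ} {μ : Measure (RN N)} {K : Set (RN N)}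
    (hK : IsCompact K) (hμ : μ K < ⊤) {f : RN N → ℝ} {g : ℕ → RN N → ℝ} {ε : ℕ → ℝ}
    (hε : Tendsto ε atTop (𝓝 0)) (hf : Continuous f) (hg : ∀ n, Continuous (g n))
    (hgK : ∀ n, ∀ x ∉ K, g n x = 0) (h : ∀ n x, |g n x - f x| ≤ ε n) :
    Tendsto (fun n => ∫ x, g n x ∂μ) atTop (𝓝 (∫ x, f x ∂μ)) := by
  obtain ⟨C, hC⟩ := hK.exists_bound_of_continuousOn hf.continuousOn
  refine tendsto_integral_filter_of_dominated_convergence (K.indicator fun _ => C + 1) ?_ ?_ ?_ ?_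
  · exact .of_forall fun n => (hg n).aestronglyMeasurable
  · filter_upwards [hε.eventually_lt_const one_pos] with n hn
    refine .of_forall fun x => ?_
    by_cases hx : x ∈ K
    · rw [indicator_of_mem hx]
      have h1 := hC x hx
      have h2 := h n x
      rw [Real.norm_eq_abs] at *
      linarith [abs_add_le (g n x - f x) (f x), congrArg abs (sub_add_cancel (g n x) (f x))]
    · simp [hx, hgK n x hx]
  · rw [integrable_indicator_iff hK.measurableSet]
    exact integrableOn_const hμ.ne
  · refine .of_forall fun x => tendsto_iff_dist_tendsto_zero.2 ?_
    exact squeeze_zero (fun _ => dist_nonneg) (fun n => h n x) hε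

theorem LocM.tendsto_intg {N : ℕ} {Ω K : Set (RN N)} (μ : LocM N Ω) (hK : IsCompact K)
    (hKΩ : K ⊆ Ω) {f : RN N → ℝ} {g : ℕ → RN N → ℝ} {ε : ℕ → ℝ}
    (hε : Tendsto ε atTop (𝓝 0)) (hf : Continuous f) (hg : ∀ n, Continuous (g n))
    (hgK : ∀ n, ∀ x ∉ K, g n x = 0) (h : ∀ n x, |g n x - f x| ≤ ε n) :
    Tendsto (fun n => μ.intg (g n)) atTop (𝓝 (μ.intg f)) := by
  have hpos : μ.pos K < ⊤ := hK.measure_lt_top_of_nhdsWithin fun x hx => by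
    obtain ⟨s, hs, hs'⟩ := μ.posLoc x (hKΩ hx)
    exact ⟨s, mem_nhdsWithin_of_mem_nhds hs, hs'⟩
  have hneg : μ.neg K < ⊤ := hK.measure_lt_top_of_nhdsWithin fun x hx => by
    obtain ⟨s, hs, hs'⟩ := μ.negLoc x (hKΩ hx)
    exact ⟨s, mem_nhdsWithin_of_mem_nhds hs, hs'⟩
  exact (tendsto_integral_of_uniform_of_compact hK hpos hε hf hg hgK h).sub
    (tendsto_integral_of_uniform_of_compact hK hneg hε hf hg hgK h)

/-- Mollification: a `C¹` test function is a `C¹`-uniform limit of smooth test functions supported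
in a fixed compact subset of `Ω`. -/
theorem IsTest1.exists_isTest_approx {N : ℕ} {Ω : Set (RN N)} (hΩ : IsOpen Ω) {φ : RN N → ℝ}
    (hφ : IsTest1 Ω φ) :
    ∃ K : Set (RN N), IsCompact K ∧ K ⊆ Ω ∧ ∀ ε > 0, ∃ g : RN N → ℝ, IsTest Ω g ∧
      tsupport g ⊆ K ∧ (∀ x, |g x - φ x| ≤ ε) ∧ ∀ x, ‖fderiv ℝ g x - fderiv ℝ φ x‖ ≤ ε := by
  obtain ⟨hC1, hcs, hsub⟩ := hφ
  obtain ⟨δ, hδ, hδΩ⟩ := hcs.isCompact.exists_cthickening_subset_open hΩ hsub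
  refine ⟨cthickening δ (tsupport φ), hcs.isCompact.cthickening, hδΩ, fun ε hε => ?_⟩
  have hd : Continuous (fderiv ℝ φ) := hC1.continuous_fderiv one_ne_zero
  obtain ⟨r₁, hr₁, h₁⟩ := Metric.uniformContinuous_iff.1
    (hcs.uniformContinuous_of_continuous hC1.continuous) ε hε
  obtain ⟨r₂, hr₂, h₂⟩ := Metric.uniformContinuous_iff.1
    ((hcs.fderiv ℝ).uniformContinuous_of_continuous hd) ε hε
  set r := min δ (min r₁ r₂) with hr
  have hrpos : 0 < r := by positivity
  let b : ContDiffBump (0 : RN N) := ⟨r / 2, r, by positivity, by linarith⟩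
  have hbint : LocallyIntegrable (b.normed volume) (volume : Measure (RN N)) :=
    b.continuous_normed.locallyIntegrable
  set g : RN N → ℝ :=
    convolution (b.normed volume) φ (ContinuousLinearMap.lsmul ℝ ℝ) volume with hg
  have hsupp : tsupport g ⊆ cthickening δ (tsupport φ) := by
    refine closure_minimal ?_ isClosed_cthickening
    refine (support_convolution_subset_swap _).trans ?_
    rintro _ ⟨y, hy, z, hz, rfl⟩
    rw [b.support_normed_eq, mem_ball_zero_iff] at hz
    refine mem_cthickening_of_dist_le _ y _ _ (subset_tsupport _ hy) ?_
    have : dist (y + z) y = ‖z‖ := by simp [dist_eq_norm]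
    exact this.trans_le (hz.le.trans (min_le_left _ _))
  have hfd : ∀ x, fderiv ℝ g x =
      convolution (b.normed volume) (fderiv ℝ φ) (ContinuousLinearMap.lsmul ℝ ℝ) volume x :=
    fun x => (hcs.hasFDerivAt_convolution_right _ hbint hC1 x).fderiv
  refine ⟨g, ⟨?_, ?_, hsupp.trans hδΩ⟩, hsupp, fun x => ?_, fun x => ?_⟩
  · exact b.hasCompactSupport_normed.contDiff_convolution_left _ b.contDiff_normed
      hC1.continuous.locallyIntegrable
  · exact hcs.isCompact.cthickening.of_isClosed_subset (isClosed_tsupport _) hsupp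
  · rw [← Real.dist_eq]
    refine b.dist_normed_convolution_le hC1.continuous.aestronglyMeasurable fun y hy => ?_
    exact (h₁ (lt_of_lt_of_le hy ((min_le_right _ _).trans (min_le_left _ _)))).le
  · rw [← dist_eq_norm, hfd]
    refine b.dist_normed_convolution_le hd.aestronglyMeasurable fun y hy => ?_
    exact (h₂ (lt_of_lt_of_le hy ((min_le_right _ _).trans (min_le_right _ _)))).le

/-- The divergence identity extends to `C¹` test functions. -/
theorem IsDivergence.of_isTest1 {N : ℕ} {Ω : Set (RN N)} (hΩ : IsOpen Ω)
    {A : Fin N → LocM N Ω} {σ : LocM N Ω} (hdiv : IsDivergence Ω A σ) {φ : RN N → ℝ}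
    (hφ : IsTest1 Ω φ) : σ.intg φ = - ∑ i, (A i).intg (gradComp φ i) := by
  obtain ⟨K, hK, hKΩ, happ⟩ := hφ.exists_isTest_approx hΩ
  choose g hg hgK hg0 hg1 using fun n : ℕ => happ (1 / ((n : ℝ) + 1)) (by positivity)
  have hε := tendsto_one_div_add_atTop_nhds_zero_nat (𝕜 := ℝ)
  have hσ : Tendsto (fun n => σ.intg (g n)) atTop (𝓝 (σ.intg φ)) :=
    σ.tendsto_intg hK hKΩ hε hφ.1.continuous (fun n => (hg n).1.continuous)
      (fun n x hx => image_eq_zero_of_notMem_tsupport fun h => hx (hgK n h)) hg0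
  have hA : ∀ i, Tendsto (fun n => (A i).intg (gradComp (g n) i)) atTop
      (𝓝 ((A i).intg (gradComp φ i))) := fun i => by
    refine (A i).tendsto_intg hK hKΩ hε ?_ (fun n => ?_) (fun n x hx => ?_) (fun n x => ?_)
    · exact (hφ.1.continuous_fderiv one_ne_zero).clm_apply continuous_const
    · exact ((hg n).1.continuous_fderiv (by simp)).clm_apply continuous_const
    · have : fderiv ℝ (g n) x = 0 :=
        image_eq_zero_of_notMem_tsupport fun h => hx (hgK n (tsupport_fderiv_subset ℝ h))
      simp [gradComp, this]
    · have := (fderiv ℝ (g n) x - fderiv ℝ φ x).le_opNorm (EuclideanSpace.single i 1)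
      simp only [PiLp.norm_single, norm_one, mul_one] at this
      exact this.trans (hg1 n x)
  refine tendsto_nhds_unique hσ ?_
  simp_rw [hdiv _ (hg _)]
  exact (tendsto_finsetSum _ fun i _ => hA i).neg

/-- The points having a ball entirely filled by `E` up to null sets. -/
def minusInterior {N : ℕ} (E : Set (RN N)) : Set (RN N) :=
  {x | ∃ r : ℝ, 0 < r ∧ volume (ball x r \ E) = 0}

/-- The points having a ball which meets `E` in a null set. -/
def minusExterior {N : ℕ} (E : Set (RN N)) : Set (RN N) :=
  {x | ∃ r : ℝ, 0 < r ∧ volume (E ∩ ball x r) = 0}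

theorem ball_sub_dist_subset {N : ℕ} {x y : RN N} {r : ℝ} : ball y (r - dist y x) ⊆ ball x r :=
  ball_subset_ball' (by linarith)

theorem isOpen_minusInterior {N : ℕ} (E : Set (RN N)) : IsOpen (minusInterior E) := by
  refine Metric.isOpen_iff.2 fun x ⟨r, hr, h⟩ => ⟨r, hr, fun y hy => ?_⟩
  exact ⟨r - dist y x, sub_pos.2 hy,
    measure_mono_null (sdiff_subset_sdiff_left ball_sub_dist_subset) h⟩

theorem isOpen_minusExterior {N : ℕ} (E : Set (RN N)) : IsOpen (minusExterior E) := by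
  refine Metric.isOpen_iff.2 fun x ⟨r, hr, h⟩ => ⟨r, hr, fun y hy => ?_⟩
  exact ⟨r - dist y x, sub_pos.2 hy,
    measure_mono_null (inter_subset_inter_right _ ball_sub_dist_subset) h⟩

theorem disjoint_minusInterior_minusExterior {N : ℕ} (E : Set (RN N)) :
    Disjoint (minusInterior E) (minusExterior E) := by
  refine Set.disjoint_left.2 fun x ⟨r, hr, h⟩ ⟨s, hs, h'⟩ => ?_
  refine (measure_ball_pos volume x (lt_min hr hs)).ne' ?_
  refine measure_mono_null (fun y hy => ?_) (measure_union_null h h')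
  by_cases hyE : y ∈ E
  · exact .inr ⟨hyE, ball_subset_ball (min_le_right _ _) hy⟩
  · exact .inl ⟨ball_subset_ball (min_le_left _ _) hy, hyE⟩

theorem mem_minusInterior_or_minusExterior {N : ℕ} {E : Set (RN N)} (hE : MeasurableSet E)
    {x : RN N} (hx : x ∉ minusBdry E) : x ∈ minusInterior E ∨ x ∈ minusExterior E := by
  simp only [minusBdry, mem_ofPred_eq, not_forall, not_and_or, not_lt] at hx
  obtain ⟨r, hr, h | h⟩ := hx
  · exact .inr ⟨r, hr, nonpos_iff_eq_zero.1 h⟩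
  · refine .inl ⟨r, hr, ?_⟩
    have hfin : volume (E ∩ ball x r) ≠ ⊤ :=
      ne_top_of_le_ne_top measure_ball_lt_top.ne (measure_mono inter_subset_right)
    rw [← sdiff_inter_self_eq_sdiff,
      measure_sdiff inter_subset_right (hE.inter measurableSet_ball).nullMeasurableSet hfin]
    exact tsub_eq_zero_of_le h

theorem hasDensity_one_of_mem_minusInterior {N : ℕ} {E : Set (RN N)} {x : RN N}
    (hx : x ∈ minusInterior E) : hasDensity E x 1 := by
  obtain ⟨r, hr, h⟩ := hx
  refine tendsto_const_nhds.congr' ?_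
  filter_upwards [Ioo_mem_nhdsGT hr] with s hs
  have hnull : volume (ball x s \ E) = 0 :=
    measure_mono_null (sdiff_subset_sdiff_left (ball_subset_ball hs.2.le)) h
  have heq : volume (E ∩ ball x s) = volume (ball x s) := by
    rw [inter_comm]
    exact measure_inter_conull' hnull
  rw [heq, div_self]
  exact (ENNReal.toReal_pos (measure_ball_pos volume x hs.1).ne' measure_ball_lt_top.ne).ne'

theorem hasDensity_zero_of_mem_minusExterior {N : ℕ} {E : Set (RN N)} {x : RN N}
    (hx : x ∈ minusExterior E) : hasDensity E x 0 := by
  obtain ⟨r, hr, h⟩ := hx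
  refine tendsto_const_nhds.congr' ?_
  filter_upwards [Ioo_mem_nhdsGT hr] with s hs
  have hnull : volume (E ∩ ball x s) = 0 :=
    measure_mono_null (inter_subset_inter_right _ (ball_subset_ball hs.2.le)) h
  simp [hnull]

theorem chiLam_eq_one {N : ℕ} {E : Set (RN N)} (lam : RN N → ℝ) {x : RN N}
    (hx : x ∈ minusInterior E) : chiLam E lam x = 1 := by
  have h1 := hasDensity_one_of_mem_minusInterior hx
  simp [chiLam, densOne, essBdry, h1]

theorem chiLam_eq_zero {N : ℕ} {E : Set (RN N)} (lam : RN N → ℝ) {x : RN N}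
    (hx : x ∈ minusExterior E) : chiLam E lam x = 0 := by
  have h0 := hasDensity_zero_of_mem_minusExterior hx
  have h1 : ¬ hasDensity E x 1 := fun h => zero_ne_one (tendsto_nhds_unique h0 h)
  simp [chiLam, densOne, essBdry, h0, h1]

/-- Away from `∂⁻E`, multiplication by `χ_E^λ` is locally multiplication by a constant. -/
theorem chiLam_mul_eventuallyEq {N : ℕ} {E : Set (RN N)} (hE : MeasurableSet E)
    (lam : RN N → ℝ) {φ : RN N → ℝ} (hφ : Disjoint (tsupport φ) (minusBdry E)) (x : RN N) :
    (fun y => chiLam E lam y * φ y) =ᶠ[𝓝 x] fun y => chiLam E lam x * φ y := by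
  by_cases hx : x ∈ tsupport φ
  · rcases mem_minusInterior_or_minusExterior hE (Set.disjoint_left.1 hφ hx) with h | h
    · filter_upwards [(isOpen_minusInterior E).mem_nhds h] with y hy
      rw [chiLam_eq_one lam h, chiLam_eq_one lam hy]
    · filter_upwards [(isOpen_minusExterior E).mem_nhds h] with y hy
      rw [chiLam_eq_zero lam h, chiLam_eq_zero lam hy]
  · filter_upwards [notMem_tsupport_iff_eventuallyEq.1 hx] with y hy
    simp [hy]

/-- the distribution `(A, Dχ_E)_λ` is supported in `∂⁻E`. -/
theorem stmt11 {N : ℕ} (Ω : Set (RN N)) (hΩ : IsOpen Ω)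
    (A : Fin N → LocM N Ω) (σ : LocM N Ω) (hdiv : IsDivergence Ω A σ)
    (lam : RN N → ℝ) (hlam : IsLam lam)
    (E : Set (RN N)) (hE : MeasurableSet E) (hEΩ : E ⊆ Ω) :
    ∀ φ, IsTest1 Ω φ → tsupport φ ⊆ Ω \ minusBdry E →
      pairingSet A σ E lam φ = 0 := by
  intro φ hφ hsub
  have hdisj : Disjoint (tsupport φ) (minusBdry E) :=
    Set.disjoint_left.2 fun x hx => (hsub hx).2
  have hloc := chiLam_mul_eventuallyEq hE lam hdisj
  have hts : tsupport (fun y => chiLam E lam y * φ y) ⊆ tsupport φ :=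
    closure_mono (Function.support_mul_subset_right _ _)
  have htest : IsTest1 Ω fun y => chiLam E lam y * φ y := by
    refine ⟨contDiff_iff_contDiffAt.2 fun x => ?_, hφ.2.1.mul_left, hts.trans hφ.2.2⟩
    exact (contDiff_const.mul hφ.1).contDiffAt.congr_of_eventuallyEq (hloc x)
  have hgrad : ∀ i, (fun x => chiLam E lam x * gradComp φ i x) =
      gradComp (fun y => chiLam E lam y * φ y) i := fun i => by
    funext x
    rw [gradComp, gradComp, (hloc x).fderiv_eq,
      fderiv_const_mul ((hφ.1.differentiable one_ne_zero) x)]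
    simp
  simp only [pairingSet, hgrad, hdiv.of_isTest1 hΩ htest]
  ring
end
end

section
/- (Gauss–Green formula for sets of finite (A,λ)-perimeter.) Let A ∈ DM_loc(Ω), E a Borel set compactly contained in Ω, and λ : Ω → [0,1] Borel with χ_E ∈ BV^{A,λ}(Ω). Then div A(E¹) + ∫_{∂*E} λ d(div A) = -∫_{∂⁻E} d(A, Dχ_E)_λ. In particular, for λ ≡ 0: div A(E¹) = -(A, Dχ_E)_0(∂⁻E), and for λ ≡ 1: div A(E¹ ∪ ∂*E) = -(A, Dχ_E)_1(∂⁻E). -/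
open MeasureTheory Filter Topology Metric Set ENNReal NNReal

noncomputable section

section Density

variable {N : ℕ}

lemma volume_inter_ball_ne_top (E : Set (RN N)) (x : RN N) (r : ℝ) :
    volume (E ∩ ball x r) ≠ ⊤ :=
  ((measure_mono inter_subset_right).trans_lt measure_ball_lt_top).ne

lemma tendsto_volume_inter_ball_left (E : Set (RN N)) (x : RN N) {r : ℝ} {u : ℕ → ℝ}
    (hu : Monotone u) (hlt : ∀ n, u n < r) (hlim : Tendsto u atTop (𝓝 r)) :
    Tendsto (fun n => (volume (E ∩ ball x (u n))).toReal) atTop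
      (𝓝 (volume (E ∩ ball x r)).toReal) := by
  have hunion : ⋃ n, E ∩ ball x (u n) = E ∩ ball x r := by
    ext y
    simp only [mem_iUnion, mem_inter_iff, mem_ball]
    constructor
    · rintro ⟨n, hy, hn⟩
      exact ⟨hy, hn.trans (hlt n)⟩
    · rintro ⟨hy, hr⟩
      obtain ⟨n, hn⟩ := (hlim.eventually (lt_mem_nhds hr)).exists
      exact ⟨n, hy, hn⟩
  have hmono : Monotone fun n => E ∩ ball x (u n) := fun m n hmn =>
    inter_subset_inter_right _ (ball_subset_ball (hu hmn))
  have h := tendsto_measure_iUnion_atTop (μ := volume) hmono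
  rw [hunion] at h
  exact (ENNReal.tendsto_toReal (volume_inter_ball_ne_top E x r)).comp h

lemma tendsto_volume_ratio_left (E : Set (RN N)) (x : RN N) {r : ℝ} (hr : 0 < r) {u : ℕ → ℝ}
    (hu : Monotone u) (hlt : ∀ n, u n < r) (hlim : Tendsto u atTop (𝓝 r)) :
    Tendsto (fun n => (volume (E ∩ ball x (u n))).toReal / (volume (ball x (u n))).toReal) atTop
      (𝓝 ((volume (E ∩ ball x r)).toReal / (volume (ball x r)).toReal)) := by
  have hden := tendsto_volume_inter_ball_left univ x hu hlt hlim
  simp only [univ_inter] at hden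
  exact (tendsto_volume_inter_ball_left E x hu hlt hlim).div hden
    (ENNReal.toReal_pos (measure_ball_pos volume x hr).ne' measure_ball_lt_top.ne).ne'

lemma measurable_volume_inter_ball {E : Set (RN N)} (hE : MeasurableSet E) (r : ℝ) :
    Measurable fun x : RN N => volume (E ∩ ball x r) := by
  have hs : MeasurableSet {p : RN N × RN N | p.2 ∈ E ∧ dist p.2 p.1 < r} :=
    (measurable_snd hE).inter
      (isOpen_lt (continuous_snd.dist continuous_fst) continuous_const).measurableSet
  exact measurable_measure_prodMk_left (ν := (volume : Measure (RN N))) hs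

/-- By left continuity of the volume ratio in the radius, rational radii and tolerances suffice. -/
lemma hasDensity_iff_rat (E : Set (RN N)) (x : RN N) (d : ℝ) :
    hasDensity E x d ↔ ∀ n : ℕ, ∃ m : ℕ, ∀ q : ℚ, 0 < q → (q : ℝ) < 1 / ((m : ℝ) + 1) →
      |(volume (E ∩ ball x q)).toReal / (volume (ball x q)).toReal - d| ≤ 1 / ((n : ℝ) + 1) := by
  constructor
  · intro h n
    have hn : (0 : ℝ) < 1 / ((n : ℝ) + 1) := Nat.one_div_pos_of_nat
    have hev := h.eventually (Metric.closedBall_mem_nhds d hn)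
    obtain ⟨δ, hδ, hsub⟩ := mem_nhdsGT_iff_exists_Ioo_subset.1 hev
    obtain ⟨m, hm⟩ := exists_nat_one_div_lt (show (0 : ℝ) < δ from hδ)
    refine ⟨m, fun q hq hqm => ?_⟩
    have := hsub ⟨Rat.cast_pos.2 hq, hqm.trans hm⟩
    simpa [Real.dist_eq] using this
  · intro h
    refine Metric.tendsto_nhds.2 fun ε hε => ?_
    obtain ⟨n, hn⟩ := exists_nat_one_div_lt hε
    obtain ⟨m, hm⟩ := h n
    have hmpos : (0 : ℝ) < 1 / ((m : ℝ) + 1) := Nat.one_div_pos_of_nat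
    filter_upwards [Ioo_mem_nhdsGT hmpos] with r hr
    obtain ⟨u, hu, hlt, hlim⟩ := Real.exists_seq_rat_strictMono_tendsto r
    have hpos : ∀ᶠ k in atTop, (0 : ℝ) < u k := hlim.eventually (lt_mem_nhds hr.1)
    have hlim' := ((tendsto_volume_ratio_left E x hr.1 (u := fun k => (u k : ℝ))
      (fun a b hab => Rat.cast_le.2 (hu.monotone hab)) hlt hlim).sub_const d).abs
    refine (le_of_tendsto hlim' ?_).trans_lt hn
    filter_upwards [hpos] with k hk
    exact hm _ (Rat.cast_pos.1 hk) ((hlt k).trans hr.2)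

lemma measurableSet_hasDensity {E : Set (RN N)} (hE : MeasurableSet E) (d : ℝ) :
    MeasurableSet {x | hasDensity E x d} := by
  have hfun (q : ℚ) : Measurable fun x : RN N =>
      |(volume (E ∩ ball x q)).toReal / (volume (ball x (q : ℝ))).toReal - d| := by
    have hball := measurable_volume_inter_ball (N := N) MeasurableSet.univ q
    simp only [univ_inter] at hball
    exact (((measurable_volume_inter_ball hE q).ennreal_toReal.div
      hball.ennreal_toReal).sub_const d).abs
  simp only [hasDensity_iff_rat, ofPred_forall, ofPred_exists]
  exact MeasurableSet.iInter fun n => MeasurableSet.iUnion fun m => MeasurableSet.iInter fun q =>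
    MeasurableSet.iInter fun _ => MeasurableSet.iInter fun _ =>
      measurableSet_le (hfun q) measurable_const

lemma measurableSet_densOne {E : Set (RN N)} (hE : MeasurableSet E) :
    MeasurableSet (densOne E) :=
  measurableSet_hasDensity hE 1

lemma measurableSet_essBdry {E : Set (RN N)} (hE : MeasurableSet E) :
    MeasurableSet (essBdry E) :=
  (measurableSet_hasDensity hE 0).compl.inter (measurableSet_hasDensity hE 1).compl

lemma disjoint_densOne_essBdry (E : Set (RN N)) : Disjoint (densOne E) (essBdry E) :=
  disjoint_left.2 fun _ h1 h2 => h2.2 h1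

lemma hasDensity_zero_of_null {E : Set (RN N)} {x : RN N} {r : ℝ} (hr : 0 < r)
    (h : volume (E ∩ ball x r) = 0) : hasDensity E x 0 := by
  refine tendsto_const_nhds.congr' ?_
  filter_upwards [Ioo_mem_nhdsGT hr] with s hs
  rw [measure_mono_null (inter_subset_inter_right _ (ball_subset_ball hs.2.le)) h]
  simp

lemma hasDensity_one_of_null_diff {E : Set (RN N)} {x : RN N} {r : ℝ} (hr : 0 < r)
    (h : volume (ball x r \ E) = 0) : hasDensity E x 1 := by
  refine tendsto_const_nhds.congr' ?_
  filter_upwards [Ioo_mem_nhdsGT hr] with s hs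
  have hnull : volume (ball x s \ E) = 0 :=
    measure_mono_null (sdiff_subset_sdiff_left (ball_subset_ball hs.2.le)) h
  rw [inter_comm, measure_inter_conull' hnull, div_self]
  exact (ENNReal.toReal_pos (measure_ball_pos volume x hs.1).ne' measure_ball_lt_top.ne).ne'

lemma hasDensity_zero_of_notMem_closure {E : Set (RN N)} {x : RN N} (hx : x ∉ closure E) :
    hasDensity E x 0 := by
  obtain ⟨r, hr, hsub⟩ := Metric.mem_nhds_iff.1 (isClosed_closure.isOpen_compl.mem_nhds hx)
  refine hasDensity_zero_of_null hr ?_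
  have : E ∩ ball x r = ∅ :=
    eq_empty_of_forall_notMem fun y hy => hsub hy.2 (subset_closure hy.1)
  simp [this]

lemma hasDensity_unique {E : Set (RN N)} {x : RN N} {c d : ℝ} (hc : hasDensity E x c)
    (hd : hasDensity E x d) : c = d :=
  tendsto_nhds_unique hc hd

lemma densOne_subset_closure (E : Set (RN N)) : densOne E ⊆ closure E := fun _ hx => by
  by_contra h
  exact zero_ne_one (hasDensity_unique (hasDensity_zero_of_notMem_closure h) hx)

lemma essBdry_subset_closure (E : Set (RN N)) : essBdry E ⊆ closure E := fun _ hx => by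
  by_contra h
  exact hx.1 (hasDensity_zero_of_notMem_closure h)

lemma minusBdry_subset_closure (E : Set (RN N)) : minusBdry E ⊆ closure E := fun x hx => by
  refine Metric.mem_closure_iff.2 fun r hr => ?_
  obtain ⟨y, hy, hyr⟩ := nonempty_of_measure_ne_zero (hx r hr).1.ne'
  exact ⟨y, hy, mem_ball'.1 hyr⟩

lemma chiLam_of_hasDensity_zero {E : Set (RN N)} (lam : RN N → ℝ) {x : RN N}
    (h : hasDensity E x 0) : chiLam E lam x = 0 := by
  have h1 : x ∉ densOne E := fun h' => zero_ne_one (hasDensity_unique h h')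
  have h2 : x ∉ essBdry E := fun h' => h'.1 h
  simp [chiLam, h1, h2]

lemma chiLam_of_hasDensity_one {E : Set (RN N)} (lam : RN N → ℝ) {x : RN N}
    (h : hasDensity E x 1) : chiLam E lam x = 1 := by
  have h1 : x ∈ densOne E := h
  have h2 : x ∉ essBdry E := fun h' => h'.2 h
  simp [chiLam, h1, h2]

lemma exists_ball_chiLam_const {E : Set (RN N)} (hE : MeasurableSet E) (lam : RN N → ℝ)
    {x : RN N} (hx : x ∉ minusBdry E) :
    ∃ r > 0, ∃ c : ℝ, ∀ y ∈ ball x r, chiLam E lam y = c := by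
  simp only [minusBdry, mem_ofPred_eq, not_forall, not_and_or, not_lt, nonpos_iff_eq_zero] at hx
  obtain ⟨r, hr, h | h⟩ := hx
  · refine ⟨r, hr, 0, fun y hy => chiLam_of_hasDensity_zero lam ?_⟩
    obtain ⟨s, hs, hsub⟩ := Metric.mem_nhds_iff.1 (isOpen_ball.mem_nhds hy)
    exact hasDensity_zero_of_null hs (measure_mono_null (inter_subset_inter_right _ hsub) h)
  · refine ⟨r, hr, 1, fun y hy => chiLam_of_hasDensity_one lam ?_⟩
    have hnull : volume (ball x r \ E) = 0 := by
      have hadd := measure_inter_add_sdiff (μ := volume) (ball x r) hE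
      rw [inter_comm] at hadd
      have hle : volume (E ∩ ball x r) + volume (ball x r \ E) ≤ volume (E ∩ ball x r) + 0 := by
        rw [hadd, add_zero]
        exact h
      exact nonpos_iff_eq_zero.1
        ((ENNReal.add_le_add_iff_left (volume_inter_ball_ne_top E x r)).1 hle)
    obtain ⟨s, hs, hsub⟩ := Metric.mem_nhds_iff.1 (isOpen_ball.mem_nhds hy)
    exact hasDensity_one_of_null_diff hs (measure_mono_null (sdiff_subset_sdiff_left hsub) hnull)

end Density

namespace LocM

variable {N : ℕ} {Ω : Set (RN N)}

lemma pos_lt_top (μ : LocM N Ω) {K : Set (RN N)} (hK : IsCompact K) (hKΩ : K ⊆ Ω) :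
    μ.pos K < ⊤ :=
  hK.measure_lt_top_of_nhdsWithin fun x hx => by
    obtain ⟨s, hs, hlt⟩ := μ.posLoc x (hKΩ hx)
    exact ⟨s, mem_nhdsWithin_of_mem_nhds hs, hlt⟩

lemma neg_lt_top (μ : LocM N Ω) {K : Set (RN N)} (hK : IsCompact K) (hKΩ : K ⊆ Ω) :
    μ.neg K < ⊤ :=
  hK.measure_lt_top_of_nhdsWithin fun x hx => by
    obtain ⟨s, hs, hlt⟩ := μ.negLoc x (hKΩ hx)
    exact ⟨s, mem_nhdsWithin_of_mem_nhds hs, hlt⟩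

lemma intg_const_mul (μ : LocM N Ω) (c : ℝ) (f : RN N → ℝ) :
    μ.intg (fun x => c * f x) = c * μ.intg f := by
  simp only [intg, integral_const_mul, mul_sub]

end LocM

section SingularPair

variable {N : ℕ}

/-- Two mutually singular finite measures with the same integrals of test functions supported in
an open set both vanish on this set. -/
lemma measure_eq_zero_of_integral_test_eq {m n : Measure (RN N)} [IsFiniteMeasure m]
    [IsFiniteMeasure n] (hmn : m ⟂ₘ n) {U : Set (RN N)} (hU : IsOpen U)
    (h : ∀ φ, IsTest U φ → ∫ x, φ x ∂m = ∫ x, φ x ∂n) : m U = 0 ∧ n U = 0 := by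
  classical
  obtain ⟨S, hS, hmS, hnS⟩ := hmn
  set f : RN N → ℝ := fun x => if x ∈ S then -1 else 1 with hf
  have hfm : ∀ᵐ x ∂m, f x = 1 := by
    filter_upwards [measure_eq_zero_iff_ae_notMem.1 hmS] with x hx
    simp [hf, hx]
  have hfn : ∀ᵐ x ∂n, f x = -1 := by
    filter_upwards [measure_eq_zero_iff_ae_notMem.1 hnS] with x hx
    simp only [mem_compl_iff, not_not] at hx
    simp [hf, hx]
  have hfmeas : Measurable f := Measurable.ite hS measurable_const measurable_const
  have hfint : Integrable f (m + n) := by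
    refine Integrable.of_bound hfmeas.aestronglyMeasurable 1 (ae_of_all _ fun x => ?_)
    by_cases hx : x ∈ S <;> simp [hf, hx]
  have hzero : ∀ᵐ x ∂(m + n), x ∈ U → f x = 0 := by
    refine hU.ae_eq_zero_of_integral_contDiff_smul_eq_zero
      (hfint.locallyIntegrable.locallyIntegrableOn U) fun g hg hgc hgU => ?_
    have hgi (ν : Measure (RN N)) [IsFiniteMeasure ν] : Integrable (fun x => g x • f x) ν := by
      have hgν : Integrable g ν := hg.continuous.integrable_of_hasCompactSupport hgc
      refine hgν.mul_bdd (c := 1) hfmeas.aestronglyMeasurable (ae_of_all _ fun x => ?_)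
      by_cases hx : x ∈ S <;> simp [hf, hx]
    rw [integral_add_measure (hgi m) (hgi n),
      integral_congr_ae (g := g) (hfm.mono fun x hx => by simp [hx]),
      integral_congr_ae (g := fun x => -g x) (hfn.mono fun x hx => by simp [hx]),
      integral_neg, h g ⟨hg, hgc, hgU⟩, add_neg_cancel]
  have hnull : (m + n) U = 0 := by
    refine measure_eq_zero_iff_ae_notMem.2 (hzero.mono fun x hx hxU => ?_)
    have := hx hxU
    by_cases hxS : x ∈ S <;> simp [hf, hxS] at this
  simpa using hnull

end SingularPair

section Pairing

variable {N : ℕ} {Ω : Set (RN N)}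

lemma IsTest.mono {U V : Set (RN N)} {φ : RN N → ℝ} (h : IsTest U φ) (hUV : U ⊆ V) :
    IsTest V φ :=
  ⟨h.1, h.2.1, h.2.2.trans hUV⟩

lemma gradComp_eq_zero_of_notMem_tsupport {φ : RN N → ℝ} {x : RN N} (hx : x ∉ tsupport φ)
    (i : Fin N) : gradComp φ i x = 0 := by
  rw [gradComp, fderiv_of_notMem_tsupport ℝ hx, _root_.zero_apply]

lemma pairingSet_eq_zero_of_chiLam_const {A : Fin N → LocM N Ω} {σ : LocM N Ω}
    (hdiv : IsDivergence Ω A σ) {E : Set (RN N)} {lam : RN N → ℝ} {U : Set (RN N)} {c : ℝ}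
    (hc : ∀ y ∈ U, chiLam E lam y = c) {φ : RN N → ℝ} (hφ : IsTest Ω φ) (hφU : tsupport φ ⊆ U) :
    pairingSet A σ E lam φ = 0 := by
  have h1 : (fun x => chiLam E lam x * φ x) = fun x => c * φ x := by
    ext x
    by_cases hx : x ∈ tsupport φ
    · rw [hc x (hφU hx)]
    · simp [image_eq_zero_of_notMem_tsupport hx]
  have h2 (i : Fin N) :
      (fun x => chiLam E lam x * gradComp φ i x) = fun x => c * gradComp φ i x := by
    ext x
    by_cases hx : x ∈ tsupport φ
    · rw [hc x (hφU hx)]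
    · simp [gradComp_eq_zero_of_notMem_tsupport hx]
  simp only [pairingSet, h1, h2, LocM.intg_const_mul, ← Finset.mul_sum, hdiv φ hφ]
  ring

/-- The pairing measure is concentrated on `∂⁻E`. -/
lemma pairing_measure_compl_minusBdry (hΩ : IsOpen Ω) {A : Fin N → LocM N Ω} {σ : LocM N Ω}
    (hdiv : IsDivergence Ω A σ) {lam : RN N → ℝ} {E : Set (RN N)} (hE : MeasurableSet E)
    {μ : FM N Ω} (hμ : ∀ φ, IsTest Ω φ → pairingSet A σ E lam φ = μ.intg φ) :
    μ.pos (minusBdry E)ᶜ = 0 ∧ μ.neg (minusBdry E)ᶜ = 0 := by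
  have := μ.posFin
  have := μ.negFin
  have hloc : ∀ x ∈ Ω ∩ (minusBdry E)ᶜ, ∃ U ∈ 𝓝 x, μ.pos U = 0 ∧ μ.neg U = 0 := by
    rintro x ⟨hxΩ, hx⟩
    obtain ⟨r, hr, c, hc⟩ := exists_ball_chiLam_const hE lam hx
    refine ⟨ball x r ∩ Ω, inter_mem (ball_mem_nhds x hr) (hΩ.mem_nhds hxΩ),
      measure_eq_zero_of_integral_test_eq μ.singular (isOpen_ball.inter hΩ) fun φ hφ => ?_⟩
    have hφΩ := hφ.mono inter_subset_right
    have h := hμ φ hφΩ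
    rw [pairingSet_eq_zero_of_chiLam_const hdiv hc hφΩ (hφ.2.2.trans inter_subset_left)] at h
    exact sub_eq_zero.1 h.symm
  have hcover : (minusBdry E)ᶜ ⊆ (Ω ∩ (minusBdry E)ᶜ) ∪ Ωᶜ := fun x hx => by
    by_cases hxΩ : x ∈ Ω
    · exact Or.inl ⟨hxΩ, hx⟩
    · exact Or.inr hxΩ
  refine ⟨measure_mono_null hcover (measure_union_null ?_ μ.posNull),
    measure_mono_null hcover (measure_union_null ?_ μ.negNull)⟩
  · refine measure_null_of_locally_null _ fun x hx => ?_
    obtain ⟨U, hU, h, -⟩ := hloc x hx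
    exact ⟨U, mem_nhdsWithin_of_mem_nhds hU, h⟩
  · refine measure_null_of_locally_null _ fun x hx => ?_
    obtain ⟨U, hU, -, h⟩ := hloc x hx
    exact ⟨U, mem_nhdsWithin_of_mem_nhds hU, h⟩

lemma exists_isTest_eq_one_nhds (hΩ : IsOpen Ω) {K : Set (RN N)} (hK : IsCompact K)
    (hKΩ : K ⊆ Ω) : ∃ φ, IsTest Ω φ ∧ ∀ x ∈ K, φ =ᶠ[𝓝 x] fun _ => 1 := by
  obtain ⟨L, hL, hKL, hLΩ⟩ := exists_compact_between hK hΩ hKΩ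
  obtain ⟨f, h1, h0, -⟩ := exists_contMDiffMap_one_nhds_of_subset_interior
    (n := (⊤ : ℕ∞)) (modelWithCornersSelf ℝ (RN N)) hK.isClosed hKL
  refine ⟨f, ⟨f.contMDiff.contDiff, HasCompactSupport.intro hL h0, ?_⟩, fun x hx => ?_⟩
  · refine (closure_minimal (fun x hx => ?_) hL.isClosed).trans hLΩ
    by_contra hxL
    exact hx (h0 x hxL)
  · exact (eventually_nhdsSet_iff_forall.1 h1) x hx

lemma FM.intg_eq_rval_of_compl_null (μ : FM N Ω) {S : Set (RN N)} (hpos : μ.pos Sᶜ = 0)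
    (hneg : μ.neg Sᶜ = 0) {φ : RN N → ℝ} (hφ : ∀ x ∈ S, φ x = 1) : μ.intg φ = μ.rval S := by
  have key (ν : Measure (RN N)) (hν : ν Sᶜ = 0) : ∫ x, φ x ∂ν = (ν S).toReal := by
    have hS : ∀ᵐ x ∂ν, x ∈ S := hν
    rw [integral_congr_ae (g := fun _ => (1 : ℝ)) (hS.mono hφ), integral_const,
      smul_eq_mul, mul_one, Measure.real, ← measure_congr (eventuallyEq_univ.2 hS)]
    rfl
  rw [FM.intg, FM.rval, key _ hpos, key _ hneg]

lemma integral_chiLam_eq {lam : RN N → ℝ} (hlam : IsLam lam) {E : Set (RN N)}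
    (hE : MeasurableSet E) {ν : Measure (RN N)} (hν : ν (closure E) < ⊤) :
    ∫ x, chiLam E lam x ∂ν = (ν (densOne E)).toReal
      + ∫ x, (essBdry E).indicator (fun _ => (1 : ℝ)) x * lam x ∂ν := by
  have hD := measurableSet_densOne hE
  have hB := measurableSet_essBdry hE
  have hDi : Integrable ((densOne E).indicator fun _ => (1 : ℝ)) ν :=
    (integrable_indicator_iff hD).2
      (integrableOn_const ((measure_mono (densOne_subset_closure E)).trans_lt hν).ne)
  have hBi : Integrable ((essBdry E).indicator fun _ => (1 : ℝ)) ν :=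
    (integrable_indicator_iff hB).2
      (integrableOn_const ((measure_mono (essBdry_subset_closure E)).trans_lt hν).ne)
  have hBl : Integrable (fun x => (essBdry E).indicator (fun _ => (1 : ℝ)) x * lam x) ν := by
    refine hBi.mul_bdd (c := 1) hlam.1.aestronglyMeasurable (ae_of_all _ fun x => ?_)
    rw [Real.norm_eq_abs, abs_of_nonneg (hlam.2 x).1]
    exact (hlam.2 x).2
  simp only [chiLam, mul_comm (lam _)]
  rw [integral_add hDi hBl, integral_indicator hD, setIntegral_const]
  simp [Measure.real]

end Pairing

/-- Gauss–Green formula for a set of finite `(A,λ)`-perimeter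
compactly contained in `Ω`:
`div A(E¹) + ∫_{∂*E} λ d(div A) = -(A, Dχ_E)_λ(∂⁻E)`;
for `λ ≡ 0` and `λ ≡ 1` one gets `div A(E¹) = -(A,Dχ_E)_0(∂⁻E)` and
`div A(E¹ ∪ ∂*E) = -(A,Dχ_E)_1(∂⁻E)`. -/
theorem stmt15 {N : ℕ} (Ω : Set (RN N)) (hΩ : IsOpen Ω)
    (A : Fin N → LocM N Ω) (σ : LocM N Ω) (hdiv : IsDivergence Ω A σ)
    (lam : RN N → ℝ) (hlam : IsLam lam)
    (E : Set (RN N)) (hE : MeasurableSet E)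
    (hcpt : IsCompact (closure E)) (hEΩ : closure E ⊆ Ω)
    (hint1 : Integrable (chiLam E lam) (varSum A))
    (hint2 : Integrable (chiLam E lam) σ.var)
    (μ : FM N Ω) (hμ : ∀ φ, IsTest Ω φ → pairingSet A σ E lam φ = μ.intg φ) :
    (σ.rval (densOne E)
        + σ.intg (fun x => (essBdry E).indicator (fun _ => (1:ℝ)) x * lam x)
      = - μ.rval (minusBdry E)) ∧
    (lam = (fun _ => 0) → σ.rval (densOne E) = - μ.rval (minusBdry E)) ∧
    (lam = (fun _ => 1) →
      σ.rval (densOne E ∪ essBdry E) = - μ.rval (minusBdry E)) := by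
  obtain ⟨hpos, hneg⟩ := pairing_measure_compl_minusBdry hΩ hdiv hE hμ
  obtain ⟨φ, hφ, hφ1⟩ := exists_isTest_eq_one_nhds hΩ hcpt hEΩ
  have hchi : ∀ x ∉ closure E, chiLam E lam x = 0 := fun x hx =>
    chiLam_of_hasDensity_zero lam (hasDensity_zero_of_notMem_closure hx)
  have hf1 : (fun x => chiLam E lam x * φ x) = chiLam E lam := by
    ext x
    by_cases hx : x ∈ closure E
    · rw [(hφ1 x hx).eq_of_nhds, mul_one]
    · rw [hchi x hx, zero_mul]
  have hf2 (i : Fin N) : (fun x => chiLam E lam x * gradComp φ i x) = fun _ => 0 := by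
    ext x
    by_cases hx : x ∈ closure E
    · rw [gradComp, (hφ1 x hx).fderiv_eq]
      simp
    · rw [hchi x hx, zero_mul]
  have hpair : -σ.intg (chiLam E lam) = μ.rval (minusBdry E) := by
    have h := hμ φ hφ
    rw [μ.intg_eq_rval_of_compl_null hpos hneg fun x hx =>
      (hφ1 x (minusBdry_subset_closure E hx)).eq_of_nhds] at h
    rw [← h, pairingSet, hf1]
    simp only [hf2]
    simp [LocM.intg]
  have hσpos := σ.pos_lt_top hcpt hEΩ
  have hσneg := σ.neg_lt_top hcpt hEΩ
  have main : σ.rval (densOne E)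
      + σ.intg (fun x => (essBdry E).indicator (fun _ => (1:ℝ)) x * lam x)
      = - μ.rval (minusBdry E) := by
    rw [← hpair, neg_neg, LocM.intg, LocM.intg, LocM.rval, integral_chiLam_eq hlam hE hσpos,
      integral_chiLam_eq hlam hE hσneg]
    ring
  refine ⟨main, fun h0 => ?_, fun h1 => ?_⟩
  · rw [← main, h0]
    simp [LocM.intg]
  · have hB := measurableSet_essBdry hE
    have key (ν : Measure (RN N)) (hν : ν (closure E) < ⊤) :
        (ν (densOne E ∪ essBdry E)).toReal = (ν (densOne E)).toReal + (ν (essBdry E)).toReal := by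
      rw [measure_union (disjoint_densOne_essBdry E) hB, ENNReal.toReal_add
        ((measure_mono (densOne_subset_closure E)).trans_lt hν).ne
        ((measure_mono (essBdry_subset_closure E)).trans_lt hν).ne]
    rw [← main, h1, LocM.rval, LocM.rval, LocM.intg, key _ hσpos, key _ hσneg]
    simp only [mul_one, integral_indicator hB, setIntegral_const, Measure.real, smul_eq_mul]
    ring
end
end
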